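/- There exists a constant K₂ > 0, depending only on n, such that for every tensor H as in the context, every ε > 0, every smooth vector field V on ℝ^n_+, and every r ≥ ε: Σ_{2 ≤ |α| ≤ d} Σ_{i,k=1}^n |h_{ik,α}|² ε^{n−2} r^{2|α|+2−n} ≤ K₂ ∫_{(B_{2r}(0) \ B_r(0)) ∩ ℝ^n_+} Σ_{i,k,l=1}^n |Q_{ik,l}(x)|² dx. -/

import Mathlib

noncomputable section

open MeasureTheory Metric

/-- Euclidean space `ℝ^n`. -/
abbrev Euc (n : ℕ) := EuclideanSpace ℝ (Fin n)

/-- Partial derivative in the `i`-th coordinate direction. -/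
def pd {n : ℕ} (i : Fin n) (f : Euc n → ℝ) : Euc n → ℝ :=
  fun x => fderiv ℝ f x (EuclideanSpace.single i 1)

/-- Kronecker delta. -/
def kd {n : ℕ} (i k : Fin n) : ℝ := if i = k then 1 else 0

/-- The finite set of multi-indices `α` with `2 ≤ |α| ≤ d`. -/
def MIdx (n d : ℕ) : Finset (Fin n → ℕ) :=
  (Fintype.piFinset fun _ : Fin n => Finset.range (d + 1)).filter
    fun α => 2 ≤ ∑ i, α i ∧ ∑ i, α i ≤ d

/-- The standard bubble `u_ε(x) = (ε/(ε² + |x|²))^{(n-2)/2}`. -/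
def uE (n : ℕ) (ε : ℝ) : Euc n → ℝ :=
  fun x => (ε / (ε ^ 2 + ‖x‖ ^ 2)) ^ (((n : ℝ) - 2) / 2)

/-- `S_{ik} = ∂_i V_k + ∂_k V_i - (2/n) (div V) δ_{ik}`. -/
def Sop {n : ℕ} (V : Fin n → Euc n → ℝ) (i k : Fin n) : Euc n → ℝ :=
  fun x => pd i (V k) x + pd k (V i) x - (2 / (n : ℝ)) * (∑ m, pd m (V m) x) * kd i k

/-- `T_{ik} = H_{ik} - S_{ik}`. -/
def Tten {n : ℕ} (H : Fin n → Fin n → Euc n → ℝ) (V : Fin n → Euc n → ℝ) (i k : Fin n) :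
    Euc n → ℝ :=
  fun x => H i k x - Sop V i k x

/-- The tensor `Q_{ik,l}`. -/
def Qop {n : ℕ} (ε : ℝ) (H : Fin n → Fin n → Euc n → ℝ) (V : Fin n → Euc n → ℝ)
    (i k l : Fin n) : Euc n → ℝ :=
  fun x =>
    uE n ε x * pd l (Tten H V i k) x
      - (2 / ((n : ℝ) - 2)) * pd i (uE n ε) x * Tten H V k l x
      - (2 / ((n : ℝ) - 2)) * pd k (uE n ε) x * Tten H V i l x
      + (2 / ((n : ℝ) - 2)) * (∑ p, pd p (uE n ε) x * Tten H V i p x) * kd k l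
      + (2 / ((n : ℝ) - 2)) * (∑ p, pd p (uE n ε) x * Tten H V k p x) * kd i l

/-- The function `w = Σ_l ∂_l u_ε V_l + ((n-2)/(2n)) u_ε div V`. -/
def wop {n : ℕ} (ε : ℝ) (V : Fin n → Euc n → ℝ) : Euc n → ℝ :=
  fun x => (∑ l, pd l (uE n ε) x * V l x)
    + (((n : ℝ) - 2) / (2 * (n : ℝ))) * uE n ε x * (∑ l, pd l (V l) x)

namespace S5
open MvPolynomial

section alg
variable {ι σ : Type} [Fintype ι] [DecidableEq ι] [Fintype σ] [DecidableEq σ]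

theorem pderiv_comm' (i j : ι) (p : MvPolynomial ι ℝ) :
    pderiv i (pderiv j p) = pderiv j (pderiv i p) := by
  ext m
  simp only [coeff_pderiv, Finsupp.add_apply]
  rw [add_right_comm]
  by_cases h : i = j
  · subst h; ring
  · rw [Finsupp.single_eq_of_ne h, Finsupp.single_eq_of_ne (Ne.symm h)]
    push_cast; ring

/-- Fischer pairing. -/
def fis (q : MvPolynomial ι ℝ) : MvPolynomial ι ℝ →ₗ[ℝ] ℝ :=
  (basisMonomials ι ℝ).constr ℝ fun α => (∏ i, ((α i).factorial : ℝ)) * coeff α q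

theorem fis_monomial (q : MvPolynomial ι ℝ) (α : ι →₀ ℕ) (c : ℝ) :
    fis q (monomial α c) = c * ((∏ i, ((α i).factorial : ℝ)) * coeff α q) := by
  have h : monomial α c = c • (basisMonomials ι ℝ) α := by
    simp [smul_monomial]
  rw [h, map_smul, fis, Module.Basis.constr_basis, smul_eq_mul]

theorem fis_X_mul (q p : MvPolynomial ι ℝ) (i : ι) :
    fis q (X i * p) = fis (pderiv i q) p := by
  induction p using MvPolynomial.induction_on' with
  | add p q hp hq => rw [mul_add, map_add, map_add, hp, hq]
  | monomial α c =>
    rw [X, monomial_mul, fis_monomial, fis_monomial, coeff_pderiv, add_comm (Finsupp.single i 1) α, one_mul]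
    have : (∏ j, (((α + Finsupp.single i 1 : ι →₀ ℕ) j).factorial : ℝ)) = (α i + 1) * ∏ j, ((α j).factorial : ℝ) := by
      rw [← Finset.mul_prod_erase _ _ (Finset.mem_univ i), ← Finset.mul_prod_erase Finset.univ (fun j => ((α j).factorial : ℝ)) (Finset.mem_univ i)]
      rw [Finset.prod_congr rfl (g := fun j => ((α j).factorial : ℝ))]
      · simp [Nat.factorial_succ]; ring
      · intro j hj
        rw [Finsupp.add_apply, Finsupp.single_eq_of_ne (Finset.ne_of_mem_erase hj), add_zero]
    rw [this]; ring

theorem fis_apply (q p : MvPolynomial ι ℝ) :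
    fis q p = ∑ α ∈ p.support, coeff α p * ((∏ i, ((α i).factorial : ℝ)) * coeff α q) := by
  conv_lhs => rw [p.as_sum]
  rw [map_sum]
  simp_rw [fis_monomial]

theorem fis_self_nonneg (p : MvPolynomial ι ℝ) : 0 ≤ fis p p := by
  rw [fis_apply]
  refine Finset.sum_nonneg fun α _ => ?_
  have : 0 ≤ (∏ i, ((α i).factorial : ℝ)) := by positivity
  nlinarith [mul_nonneg this (mul_self_nonneg (coeff α p))]

/-- Euler operator in the variables `e i`. -/
def Eul (e : σ → ι) (p : MvPolynomial ι ℝ) : MvPolynomial ι ℝ := ∑ i, X (e i) * pderiv (e i) p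

theorem coeff_X_pderiv (i : ι) (p : MvPolynomial ι ℝ) (α : ι →₀ ℕ) :
    coeff α (X i * pderiv i p) = α i * coeff α p := by
  rw [coeff_X_mul']
  split_ifs with h
  · rw [coeff_pderiv]
    have h1 : 1 ≤ α i := Nat.one_le_iff_ne_zero.2 (Finsupp.mem_support_iff.1 h)
    have : α - Finsupp.single i 1 + Finsupp.single i 1 = α := by
      apply tsub_add_cancel_of_le
      simpa using h1
    rw [this, Finsupp.tsub_apply, Finsupp.single_eq_same, Nat.cast_sub h1]; push_cast; ring
  · rw [Finsupp.notMem_support_iff.1 h]; simp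

theorem coeff_Eul (e : σ → ι) (p : MvPolynomial ι ℝ) (α : ι →₀ ℕ) :
    coeff α (Eul e p) = (∑ i, (α (e i) : ℝ)) * coeff α p := by
  rw [Eul, coeff_sum, Finset.sum_mul]
  exact Finset.sum_congr rfl fun i _ => coeff_X_pderiv _ _ _

theorem Eul_add (e : σ → ι) (p q : MvPolynomial ι ℝ) : Eul e (p + q) = Eul e p + Eul e q := by
  ext α; simp [coeff_Eul]; ring
theorem Eul_sub (e : σ → ι) (p q : MvPolynomial ι ℝ) : Eul e (p - q) = Eul e p - Eul e q := by
  ext α; simp [coeff_Eul]; ring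
theorem Eul_neg (e : σ → ι) (p : MvPolynomial ι ℝ) : Eul e (-p) = - Eul e p := by
  ext α; simp [coeff_Eul]
theorem Eul_sum {τ : Type} [Fintype τ] (e : σ → ι) (p : τ → MvPolynomial ι ℝ) : Eul e (∑ j, p j) = ∑ j, Eul e (p j) := by
  ext α; simp [coeff_Eul, coeff_sum, Finset.mul_sum]

theorem Eul_mul (e : σ → ι) (p q : MvPolynomial ι ℝ) :
    Eul e (p * q) = Eul e p * q + p * Eul e q := by
  simp only [Eul, pderiv_mul, Finset.sum_mul, Finset.mul_sum, ← Finset.sum_add_distrib]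
  exact Finset.sum_congr rfl fun i _ => by ring

theorem pderiv_Xe (e : σ → ι) (he : Function.Injective e) (i j : σ) :
    pderiv (e i) (X (e j) : MvPolynomial ι ℝ) = if i = j then 1 else 0 := by
  split_ifs with h
  · rw [h, pderiv_X_self]
  · exact pderiv_X_of_ne fun h' => h (he h').symm

theorem Eul_X (e : σ → ι) (he : Function.Injective e) (j : σ) :
    Eul e (X (e j) : MvPolynomial ι ℝ) = X (e j) := by
  simp [Eul, pderiv_Xe e he]

theorem pderiv_Eul (e : σ → ι) (he : Function.Injective e) (j : σ) (p : MvPolynomial ι ℝ) :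
    pderiv (e j) (Eul e p) = Eul e (pderiv (e j) p) + pderiv (e j) p := by
  simp only [Eul, map_sum, pderiv_mul, pderiv_Xe e he, Finset.sum_add_distrib]
  simp [add_comm, pderiv_comm' (e j)]

theorem Eul_add_self_inj (e : σ → ι) (p : MvPolynomial ι ℝ) (h : Eul e p + p = 0) : p = 0 := by
  ext α
  have := congrArg (coeff α) h
  rw [coeff_add, coeff_Eul, coeff_zero] at this
  have h1 : 0 ≤ ∑ i, (α (e i) : ℝ) := by positivity
  have : (∑ i, (α (e i) : ℝ) + 1) * coeff α p = 0 := by linarith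
  rcases mul_eq_zero.1 this with h | h
  · linarith
  · simpa using h

/-- Spectral lemma. -/
theorem spec_zero (e : σ → ι) (c : ℝ) (hc : 0 < c) (t : MvPolynomial ι ℝ)
    (h : ∑ k, pderiv (e k) (pderiv (e k) ((∑ j, X (e j) * X (e j)) * t)) =
      - (C c * (Eul e (Eul e t + t) + 2 * (Eul e t + t)))) : t = 0 := by
  set r2 : MvPolynomial ι ℝ := ∑ j, X (e j) * X (e j) with hr2
  have h1 : fis (r2 * t) (r2 * t) = fis (∑ k, pderiv (e k) (pderiv (e k) (r2 * t))) t := by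
    conv_lhs => 
      enter [2]
      rw [hr2, Finset.sum_mul]
    rw [map_sum]
    have hs : ∀ k, fis (r2 * t) (X (e k) * X (e k) * t) = fis (pderiv (e k) (pderiv (e k) (r2 * t))) t := by
      intro k; rw [mul_assoc, fis_X_mul, fis_X_mul]
    simp_rw [hs]
    simp_rw [fis_apply, coeff_sum, Finset.mul_sum]
    rw [Finset.sum_comm]
  rw [h] at h1
  have h2 := fis_self_nonneg (r2 * t)
  rw [h1, fis_apply] at h2
  have key : ∀ α ∈ t.support, coeff α t * ((∏ i, ((α i).factorial : ℝ)) * coeff α (-(C c * (Eul e (Eul e t + t) + 2 * (Eul e t + t))))) ≤ 0 := by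
    intro α _
    rw [coeff_neg, coeff_C_mul, two_mul]
    simp only [coeff_add, coeff_Eul]
    have a1 : 0 ≤ ∑ i, (α (e i) : ℝ) := by positivity
    have a2 : 0 < (∏ i, ((α i).factorial : ℝ)) := by positivity
    generalize (∑ i, (α (e i) : ℝ)) = s at *
    generalize (∏ i, ((α i).factorial : ℝ)) = f at *
    have : 0 ≤ f * c * ((s+2)*(s+1)) * (coeff α t * coeff α t) := by
      have := mul_self_nonneg (coeff α t); positivity
    linarith
  have h3 := (Finset.sum_eq_zero_iff_of_nonpos key).1 (le_antisymm (Finset.sum_nonpos key) h2)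
  ext α
  by_contra hne
  have hm : α ∈ t.support := by simpa using hne
  have h4 := h3 α hm
  rw [coeff_neg, coeff_C_mul, two_mul] at h4
  simp only [coeff_add, coeff_Eul] at h4
  have a1 : 0 ≤ ∑ i, (α (e i) : ℝ) := by positivity
  have a2 : 0 < (∏ i, ((α i).factorial : ℝ)) := by positivity
  generalize (∑ i, (α (e i) : ℝ)) = s at *
  generalize (∏ i, ((α i).factorial : ℝ)) = f at *
  have : 0 < f * c * ((s+2)*(s+1)) * (coeff α t * coeff α t) := by
    have : 0 < coeff α t * coeff α t := by
      rw [coeff_zero] at hne; exact mul_self_pos.2 hne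
    positivity
  linarith
end alg
end S5

namespace S5
open MvPolynomial
section alg2
variable {ι σ : Type} [Fintype ι] [DecidableEq ι] [Fintype σ] [DecidableEq σ]

/-- Kronecker delta in polynomials. -/
def dl {τ : Type} [DecidableEq τ] (i j : τ) : MvPolynomial ι ℝ := if i = j then 1 else 0

theorem cotton (e : σ → ι) (hm : 4 ≤ Fintype.card σ) (p A : σ → σ → MvPolynomial ι ℝ)
    (hA : ∀ i k, A i k = A k i)
    (hR : ∀ i j k l, pderiv (e j) (pderiv (e k) (p i l)) - pderiv (e i) (pderiv (e k) (p j l))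
      - pderiv (e j) (pderiv (e l) (p i k)) + pderiv (e i) (pderiv (e l) (p j k))
      = A i k * dl j l + A j l * dl i k - A i l * dl j k - A j k * dl i l) (m i k : σ) :
    pderiv (e m) (A i k) = pderiv (e i) (A m k) := by
  have hB : ∀ m i j k l, pderiv (e m) (A i k * dl j l + A j l * dl i k - A i l * dl j k - A j k * dl i l)
    + pderiv (e i) (A j k * dl m l + A m l * dl j k - A j l * dl m k - A m k * dl j l)
    + pderiv (e j) (A m k * dl i l + A i l * dl m k - A m l * dl i k - A i k * dl m l) = 0 := by
    intro m i j k l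
    simp only [← hR, map_add, map_sub]
    linear_combination pderiv_comm' (e m) (e j) (pderiv (e k) (p i l))
      - pderiv_comm' (e m) (e i) (pderiv (e k) (p j l))
      - pderiv_comm' (e m) (e j) (pderiv (e l) (p i k))
      + pderiv_comm' (e m) (e i) (pderiv (e l) (p j k))
      - pderiv_comm' (e i) (e j) (pderiv (e k) (p m l))
      + pderiv_comm' (e i) (e j) (pderiv (e l) (p m k))
  have hex : ∀ a b c : σ, ∃ j, j ≠ a ∧ j ≠ b ∧ j ≠ c := by
    intro a b c
    have : ∃ j, j ∉ ({a, b, c} : Finset σ) := by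
      by_contra! h
      have h1 : (Finset.univ : Finset σ) ⊆ {a, b, c} := fun x _ => h x
      have := Finset.card_le_card h1
      have h3 := Finset.card_le_three (a := a) (b := b) (c := c)
      rw [Finset.card_univ] at this
      omega
    simpa using this
  -- pairwise relation
  have hd0 : ∀ (a : σ) (i j : σ), pderiv (e a) (dl i j : MvPolynomial ι ℝ) = 0 := by
    intro a i j; unfold dl; split_ifs <;> simp
  have hC : ∀ m i k j, j ≠ m → j ≠ i → j ≠ k →
      (pderiv (e m) (A i k) - pderiv (e i) (A m k))
      + dl i k * (pderiv (e m) (A j j) - pderiv (e j) (A m j))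
      - dl m k * (pderiv (e i) (A j j) - pderiv (e j) (A i j)) = 0 := by
    intro m i k j h1 h2 h3
    have := hB m i j k j
    have e1 : (dl j j : MvPolynomial ι ℝ) = 1 := if_pos rfl
    have e2 : (dl j k : MvPolynomial ι ℝ) = 0 := if_neg h3
    have e3 : (dl i j : MvPolynomial ι ℝ) = 0 := if_neg h2.symm
    have e4 : (dl m j : MvPolynomial ι ℝ) = 0 := if_neg h1.symm
    rw [e1, e2, e3, e4] at this
    simp only [map_add, map_sub, pderiv_mul, hd0, mul_zero, mul_one, add_zero, map_zero, sub_zero, zero_add, pderiv_one, zero_sub, map_neg] at this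
    linear_combination this
  have hD : ∀ m i, m ≠ i → pderiv (e m) (A i i) - pderiv (e i) (A m i) = 0 := by
    intro m i hmi
    have two : ∀ i j, m ≠ i → m ≠ j → i ≠ j →
       (pderiv (e m) (A i i) - pderiv (e i) (A m i)) + (pderiv (e m) (A j j) - pderiv (e j) (A m j)) = 0 := by
      intro i j h1 h2 h3
      have := hC m i i j h2.symm h3.symm h3.symm
      have e1 : (dl i i : MvPolynomial ι ℝ) = 1 := if_pos rfl
      have e2 : (dl m i : MvPolynomial ι ℝ) = 0 := if_neg h1
      rw [e1, e2] at this
      linear_combination this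
    obtain ⟨j, hj1, hj2, -⟩ := hex m i i
    obtain ⟨l, hl1, hl2, hl3⟩ := hex m i j
    have q1 := two i j hmi hj1.symm hj2.symm
    have q2 := two i l hmi hl1.symm hl2.symm
    have q3 := two j l hj1.symm hl1.symm hl3.symm
    have : (C (2:ℝ)) * (pderiv (e m) (A i i) - pderiv (e i) (A m i)) = 0 := by
      rw [show (C (2:ℝ) : MvPolynomial ι ℝ) = 2 from rfl]
      linear_combination q1 + q2 - q3
    rcases mul_eq_zero.1 this with h | h
    · simp at h
    · exact h
  by_cases h1 : m = i
  · rw [h1]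
  by_cases h2 : i = k
  · subst h2; exact sub_eq_zero.1 (hD m i h1)
  by_cases h3 : m = k
  · subst h3
    have := hD i m (Ne.symm h1)
    rw [hA i m] at this ⊢
    exact (sub_eq_zero.1 (by rw [hA m i] at *; exact this)).symm
  obtain ⟨j, hj1, hj2, hj3⟩ := hex m i k
  have := hC m i k j hj1 hj2 hj3
  have e1 : (dl i k : MvPolynomial ι ℝ) = 0 := if_neg h2
  have e2 : (dl m k : MvPolynomial ι ℝ) = 0 := if_neg h3
  rw [e1, e2] at this
  linear_combination this

theorem tang_zero (e : σ → ι) (he : Function.Injective e) (hm : 4 ≤ Fintype.card σ)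
    (p A : σ → σ → MvPolynomial ι ℝ)
    (hp : ∀ i k, p i k = p k i) (hA : ∀ i k, A i k = A k i)
    (htr : ∑ i, p i i = 0) (hx : ∀ i, ∑ k, p i k * X (e k) = 0)
    (hR : ∀ i j k l, pderiv (e j) (pderiv (e k) (p i l)) - pderiv (e i) (pderiv (e k) (p j l))
      - pderiv (e j) (pderiv (e l) (p i k)) + pderiv (e i) (pderiv (e l) (p j k))
      = A i k * dl j l + A j l * dl i k - A i l * dl j k - A j k * dl i l) (i k : σ) :
    p i k = 0 := by
  have hcot := cotton e hm p A hA hR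
  have h1 : ∀ i j, ∑ k, X (e k) * pderiv (e j) (p i k) = - p i j := by
    intro i j
    have := congrArg (pderiv (e j)) (hx i)
    simp only [map_sum, pderiv_mul, pderiv_Xe e he, Finset.sum_add_distrib, map_zero] at this
    simp only [mul_ite, mul_one, mul_zero, Finset.sum_ite_eq, Finset.mem_univ, if_true] at this
    simp_rw [mul_comm (X _)]
    exact eq_neg_of_add_eq_zero_left this
  have h2 : ∀ i j l, ∑ k, X (e k) * pderiv (e l) (pderiv (e j) (p i k)) = - pderiv (e j) (p i l) - pderiv (e l) (p i j) := by
    intro i j l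
    have := congrArg (pderiv (e l)) (h1 i j)
    simp only [map_sum, pderiv_mul, pderiv_Xe e he, Finset.sum_add_distrib, map_neg] at this
    simp only [ite_mul, one_mul, zero_mul, Finset.sum_ite_eq, Finset.mem_univ, if_true] at this
    linear_combination this
  have hE2 : ∀ q : MvPolynomial ι ℝ, ∑ j, X (e j) * ∑ l, X (e l) * pderiv (e j) (pderiv (e l) q) = Eul e (Eul e q) - Eul e q := by
    intro q
    have : Eul e (Eul e q) = ∑ j, X (e j) * pderiv (e j) (Eul e q) := rfl
    rw [this]
    simp_rw [pderiv_Eul e he, mul_add, Finset.sum_add_distrib]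
    rw [show ∑ j, X (e j) * pderiv (e j) q = Eul e q from rfl, add_sub_cancel_right]
    refine Finset.sum_congr rfl fun j _ => ?_
    rw [Eul]
    simp_rw [pderiv_comm' (e j)]
  set r2 : MvPolynomial ι ℝ := ∑ j, X (e j) * X (e j) with hr2
  set a : σ → MvPolynomial ι ℝ := fun i => ∑ l, X (e l) * A i l with ha
  set ψ : MvPolynomial ι ℝ := ∑ j, X (e j) * a j with hψ
  set t : MvPolynomial ι ℝ := ∑ j, A j j with ht
  have main : ∀ i k, -(Eul e (Eul e (p i k)) + Eul e (p i k)) = r2 * A i k + ψ * dl i k - X (e k) * a i - X (e i) * a k := by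
    intro i k
    have key : ∑ j, X (e j) * ∑ l, X (e l) * (pderiv (e j) (pderiv (e k) (p i l)) - pderiv (e i) (pderiv (e k) (p j l))
      - pderiv (e j) (pderiv (e l) (p i k)) + pderiv (e i) (pderiv (e l) (p j k))) = 
       ∑ j, X (e j) * ∑ l, X (e l) * (A i k * dl j l + A j l * dl i k - A i l * dl j k - A j k * dl i l) := by
      simp_rw [hR]
    simp only [mul_add, mul_sub, Finset.sum_add_distrib, Finset.sum_sub_distrib] at key
    have t1 : ∑ j, X (e j) * ∑ l, X (e l) * pderiv (e j) (pderiv (e k) (p i l)) = - Eul e (p i k) + p i k := by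
      simp_rw [h2, mul_sub, mul_neg, Finset.sum_sub_distrib, Finset.sum_neg_distrib, h1]
      rw [Eul]; ring
    have t2 : ∑ j, X (e j) * ∑ l, X (e l) * pderiv (e i) (pderiv (e k) (p j l)) = 2 * p i k := by
      simp_rw [h2, mul_sub, mul_neg, Finset.sum_sub_distrib, Finset.sum_neg_distrib]
      have h1' : ∀ i k, ∑ j, X (e j) * pderiv (e i) (p j k) = - p k i := by
        intro i k; rw [← h1]; exact Finset.sum_congr rfl fun j _ => by rw [hp j k]
      rw [h1', h1', hp k i]; ring
    have t4 : ∑ j, X (e j) * ∑ l, X (e l) * pderiv (e i) (pderiv (e l) (p j k)) = - Eul e (p i k) + p i k := by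
      simp_rw [Finset.mul_sum]
      rw [Finset.sum_comm]
      have : ∀ l, ∑ j, X (e j) * (X (e l) * pderiv (e i) (pderiv (e l) (p j k))) = X (e l) * ∑ j, X (e j) * pderiv (e i) (pderiv (e l) (p k j)) := by
        intro l; rw [Finset.mul_sum]
        exact Finset.sum_congr rfl fun j _ => by rw [hp j k]; ring
      simp_rw [this, h2, mul_sub, Finset.sum_sub_distrib, mul_neg, Finset.sum_neg_distrib, h1]
      rw [hp k i, show ∑ j, X (e j) * pderiv (e j) (p i k) = Eul e (p i k) from rfl]
      have : ∑ x, X (e x) * pderiv (e i) (p k x) = - p i k := by rw [h1, hp]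
      first | (rw [this]; ring) | ring
    have s1 : ∑ j, X (e j) * ∑ l, X (e l) * (A i k * dl j l) = r2 * A i k := by
      simp only [dl, mul_ite, mul_one, mul_zero, Finset.sum_ite_eq, Finset.mem_univ, if_true, hr2, Finset.sum_mul]
      exact Finset.sum_congr rfl fun j _ => by ring
    have s2 : ∑ j, X (e j) * ∑ l, X (e l) * (A j l * dl i k) = ψ * dl i k := by
      simp only [hψ, ha, Finset.sum_mul, Finset.mul_sum]
      exact Finset.sum_congr rfl fun j _ => Finset.sum_congr rfl fun l _ => by ring
    have s3 : ∑ j, X (e j) * ∑ l, X (e l) * (A i l * dl j k) = X (e k) * a i := by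
      have : ∀ j, X (e j) * ∑ l, X (e l) * (A i l * dl j k) = if j = k then X (e k) * a i else 0 := by
        intro j; unfold dl
        split_ifs with h
        · subst h; simp [ha]
        · simp
      simp [this]
    have s4 : ∑ j, X (e j) * ∑ l, X (e l) * (A j k * dl i l) = X (e i) * a k := by
      simp only [dl, mul_ite, mul_one, mul_zero, Finset.sum_ite_eq, Finset.mem_univ, if_true, ha, Finset.mul_sum]
      exact Finset.sum_congr rfl fun j _ => by rw [hA j k]; ring
    rw [t1, t2, t4, hE2, s1, s2, s3, s4] at key
    linear_combination key
  have hcm : (Fintype.card σ : ℝ) - 2 > 0 := by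
    have : (4:ℝ) ≤ Fintype.card σ := by exact_mod_cast hm
    linarith
  have htrace : r2 * t = - (C ((Fintype.card σ : ℝ) - 2) * ψ) := by
    have : ∑ i, -(Eul e (Eul e (p i i)) + Eul e (p i i)) = 0 := by
      rw [Finset.sum_neg_distrib, Finset.sum_add_distrib, ← Eul_sum, ← Eul_sum, htr]
      simp [Eul]
    simp_rw [main, Finset.sum_sub_distrib, Finset.sum_add_distrib] at this
    rw [← Finset.mul_sum] at this
    have e1 : ∀ i : σ, (dl i i : MvPolynomial ι ℝ) = 1 := fun i => if_pos rfl
    simp only [e1, mul_one, Finset.sum_const, Finset.card_univ, nsmul_eq_mul] at this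
    rw [map_sub, map_natCast, show (C (2:ℝ) : MvPolynomial ι ℝ) = 2 from rfl]
    linear_combination this
  have hda : ∀ i k, pderiv (e i) (a k) = Eul e (A i k) + A i k := by
    intro i k
    simp only [ha, map_sum, pderiv_mul, pderiv_Xe e he, Finset.sum_add_distrib]
    simp only [ite_mul, one_mul, zero_mul, Finset.sum_ite_eq, Finset.mem_univ, if_true]
    rw [hA k i, add_comm, Eul]
    congr 1
    refine Finset.sum_congr rfl fun j _ => ?_
    rw [hA k j, hcot i j k]
  have hdψ : ∀ k, pderiv (e k) ψ = Eul e (a k) + a k := by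
    intro k
    simp only [hψ, map_sum, pderiv_mul, pderiv_Xe e he, Finset.sum_add_distrib, hda]
    simp only [ite_mul, one_mul, zero_mul, Finset.sum_ite_eq, Finset.mem_univ, if_true]
    have : Eul e (a k) = ∑ x, X (e x) * (Eul e (A k x) + A k x) := by
      rw [ha]; simp only [Eul_sum, Eul_mul, Eul_X e he]
      exact Finset.sum_congr rfl fun j _ => by ring
    rw [this]; ring
  have hlap : ∑ k, pderiv (e k) (pderiv (e k) ψ) = Eul e (Eul e t + t) + 2 * (Eul e t + t) := by
    simp_rw [hdψ, map_add, pderiv_Eul e he, hda]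
    rw [Eul_add, ht]
    simp only [Eul_sum, Eul_add, Finset.sum_add_distrib]
    ring
  have ht0 : t = 0 := by
    apply spec_zero e _ hcm t
    rw [← hr2, htrace, ← hlap]
    simp only [map_neg, pderiv_C_mul, Finset.sum_neg_distrib, Finset.mul_sum]
  have hψ0 : ψ = 0 := by
    rw [ht0, mul_zero] at htrace
    have := neg_eq_zero.1 htrace.symm
    rcases mul_eq_zero.1 this with h | h
    · rw [map_eq_zero_iff _ (C_injective ι ℝ)] at h; linarith
    · exact h
  have ha0 : ∀ k, a k = 0 := fun k => Eul_add_self_inj e _ (by rw [← hdψ, hψ0, map_zero])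
  have hA0 : ∀ i k, A i k = 0 := fun i k => Eul_add_self_inj e _ (by rw [← hda, ha0, map_zero])
  have hEp : ∀ i k, Eul e (p i k) = 0 := by
    intro i k
    apply Eul_add_self_inj e
    have := main i k
    rw [hA0, hψ0, ha0, ha0] at this
    linear_combination -this
  have hdp : ∀ i k l, pderiv (e l) (p i k) = 0 := by
    intro i k l
    apply Eul_add_self_inj e
    rw [← pderiv_Eul e he, hEp, map_zero]
  have := h1 i k
  simp only [hdp, mul_zero, Finset.sum_const_zero] at this
  exact neg_eq_zero.1 this.symm
end alg2
end S5

namespace S5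
open MvPolynomial
section alg3
variable {ι : Type} [Fintype ι] [DecidableEq ι]

/-- Weyl type test tensors. -/
structure IsW (w : ι → ι → ι → ι → ℝ) : Prop where
  a1 : ∀ i j k l, w j i k l = - w i j k l
  a2 : ∀ i j k l, w i j l k = - w i j k l
  tr : ∀ j l, ∑ i, w i j i l = 0

theorem weyl_alg (hn : 4 ≤ Fintype.card ι) (R : ι → ι → ι → ι → ℝ)
    (h1 : ∀ i j k l, R j i k l = - R i j k l) (h2 : ∀ i j k l, R i j l k = - R i j k l)
    (h3 : ∀ i j k l, R k l i j = R i j k l) (A : ι → ι → ℝ)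
    (hA : ∀ j l, A j l = ((∑ i, R i j i l) - (∑ i, ∑ k, R i k i k) / (2 * ((Fintype.card ι : ℝ) - 1)) * (if j = l then 1 else 0)) / ((Fintype.card ι : ℝ) - 2))
    (hW : ∀ w, IsW w → ∑ i, ∑ j, ∑ k, ∑ l, w i j k l * R i j k l = 0) (i j k l : ι) :
    R i j k l = A i k * (if j = l then 1 else 0) + A j l * (if i = k then 1 else 0)
      - A i l * (if j = k then 1 else 0) - A j k * (if i = l then 1 else 0) := by
  have hN : (4:ℝ) ≤ Fintype.card ι := by exact_mod_cast hn
  set N : ℝ := ((Fintype.card ι : ℕ) : ℝ) with hNdef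
  have hAs : ∀ j l, A j l = A l j := by
    intro j l
    rw [hA, hA]
    have : ∑ i, R i j i l = ∑ i, R i l i j := Finset.sum_congr rfl fun i _ => h3 i l i j
    rw [this]
    simp only [eq_comm]
  have htA : ∑ i, A i i = (∑ i, ∑ k, R i k i k) / (2 * (N - 1)) := by
    simp_rw [hA, ← Finset.sum_div, Finset.sum_sub_distrib]
    simp only [if_true, mul_one, Finset.sum_const, Finset.card_univ, nsmul_eq_mul, ← hNdef]
    rw [Finset.sum_comm]
    have : N - 1 ≠ 0 := by linarith
    have : N - 2 ≠ 0 := by linarith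
    field_simp
    ring
  set B : ι → ι → ι → ι → ℝ := fun i j k l => A i k * (if j = l then 1 else 0) + A j l * (if i = k then 1 else 0)
      - A i l * (if j = k then 1 else 0) - A j k * (if i = l then 1 else 0) with hB
  set w : ι → ι → ι → ι → ℝ := fun i j k l => R i j k l - B i j k l with hw
  have hw' : IsW w := by
    refine ⟨?_, ?_, ?_⟩
    · intro i j k l
      simp only [hw, hB, h1 i j k l]; ring
    · intro i j k l
      simp only [hw, hB, h2 i j k l]; ring
    · intro j l
      simp only [hw, hB, Finset.sum_sub_distrib, Finset.sum_add_distrib, if_true, mul_one, mul_ite, mul_zero, Finset.sum_const, Finset.card_univ, nsmul_eq_mul, ← hNdef, Finset.sum_ite_eq, Finset.sum_ite_eq', Finset.mem_univ]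
      have e : ∀ i, (if j = l then A i i else 0) = A i i * (if j = l then 1 else 0) := by intro i; split_ifs <;> simp
      simp_rw [e, ← Finset.sum_mul, htA]
      rw [hA j l]
      have : N - 1 ≠ 0 := by linarith
      have : N - 2 ≠ 0 := by linarith
      field_simp
      ring
  have t1 := hw'.tr
  have t2 : ∀ j k, ∑ i, w i j k i = 0 := by
    intro j k
    have : ∑ i, w i j k i = - ∑ i, w i j i k := by
      rw [← Finset.sum_neg_distrib]; exact Finset.sum_congr rfl fun i _ => hw'.a2 i j i k
    rw [this, t1, neg_zero]
  have t3 : ∀ i l, ∑ j, w i j j l = 0 := by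
    intro i l
    have : ∑ j, w i j j l = - ∑ j, w j i j l := by
      rw [← Finset.sum_neg_distrib]; exact Finset.sum_congr rfl fun j _ => hw'.a1 j i j l
    rw [this, t1, neg_zero]
  have t4 : ∀ i k, ∑ j, w i j k j = 0 := by
    intro i k
    have : ∑ j, w i j k j = - ∑ j, w i j j k := by
      rw [← Finset.sum_neg_distrib]; exact Finset.sum_congr rfl fun j _ => hw'.a2 i j j k
    rw [this, t3, neg_zero]
  have hwB : ∑ i, ∑ j, ∑ k, ∑ l, w i j k l * B i j k l = 0 := by
    have b1 : ∑ i, ∑ j, ∑ k, ∑ l, w i j k l * (A i k * (if j = l then 1 else 0)) = 0 := by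
      refine Finset.sum_eq_zero fun i _ => ?_
      rw [Finset.sum_comm]
      refine Finset.sum_eq_zero fun k _ => ?_
      simp only [mul_ite, mul_one, mul_zero, Finset.sum_ite_eq, Finset.mem_univ, if_true]
      rw [← Finset.sum_mul, t4, zero_mul]
    have b2 : ∑ i, ∑ j, ∑ k, ∑ l, w i j k l * (A j l * (if i = k then 1 else 0)) = 0 := by
      rw [Finset.sum_comm]
      refine Finset.sum_eq_zero fun j _ => ?_
      have : ∀ i, ∑ k, ∑ l, w i j k l * (A j l * (if i = k then 1 else 0)) = ∑ l, w i j i l * A j l := by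
        intro i
        rw [Finset.sum_comm]
        simp only [mul_ite, mul_one, mul_zero, Finset.sum_ite_eq, Finset.mem_univ, if_true]
      simp_rw [this]
      rw [Finset.sum_comm]
      refine Finset.sum_eq_zero fun l _ => ?_
      rw [← Finset.sum_mul, t1, zero_mul]
    have b3 : ∑ i, ∑ j, ∑ k, ∑ l, w i j k l * (A i l * (if j = k then 1 else 0)) = 0 := by
      refine Finset.sum_eq_zero fun i _ => ?_
      have : ∀ j, ∑ k, ∑ l, w i j k l * (A i l * (if j = k then 1 else 0)) = ∑ l, w i j j l * A i l := by
        intro j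
        rw [Finset.sum_comm]
        simp only [mul_ite, mul_one, mul_zero, Finset.sum_ite_eq, Finset.mem_univ, if_true]
      simp_rw [this]
      rw [Finset.sum_comm]
      refine Finset.sum_eq_zero fun l _ => ?_
      rw [← Finset.sum_mul, t3, zero_mul]
    have b4 : ∑ i, ∑ j, ∑ k, ∑ l, w i j k l * (A j k * (if i = l then 1 else 0)) = 0 := by
      rw [Finset.sum_comm]
      refine Finset.sum_eq_zero fun j _ => ?_
      rw [Finset.sum_comm]
      refine Finset.sum_eq_zero fun k _ => ?_
      simp only [mul_ite, mul_one, mul_zero, Finset.sum_ite_eq, Finset.mem_univ, if_true]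
      rw [← Finset.sum_mul, t2, zero_mul]
    simp only [hB, mul_sub, mul_add, Finset.sum_sub_distrib, Finset.sum_add_distrib] at *
    rw [b1, b2, b3, b4]; ring
  have hww : ∑ i, ∑ j, ∑ k, ∑ l, w i j k l * w i j k l = 0 := by
    have e : ∀ i j k l, w i j k l * w i j k l = w i j k l * R i j k l - w i j k l * B i j k l := by
      intro i j k l
      rw [← mul_sub]
    simp_rw [e, Finset.sum_sub_distrib]
    rw [hW w hw', hwB, sub_zero]
  have n4 : ∀ i j k, 0 ≤ ∑ l, w i j k l * w i j k l := fun i j k => Finset.sum_nonneg fun l _ => mul_self_nonneg _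
  have n3 : ∀ i j, 0 ≤ ∑ k, ∑ l, w i j k l * w i j k l := fun i j => Finset.sum_nonneg fun l _ => n4 _ _ _
  have n2 : ∀ i, 0 ≤ ∑ j, ∑ k, ∑ l, w i j k l * w i j k l := fun i => Finset.sum_nonneg fun l _ => n3 _ _
  have z1 := (Finset.sum_eq_zero_iff_of_nonneg (fun i _ => n2 i)).1 hww i (Finset.mem_univ _)
  have z2 := (Finset.sum_eq_zero_iff_of_nonneg (fun j _ => n3 i j)).1 z1 j (Finset.mem_univ _)
  have z3 := (Finset.sum_eq_zero_iff_of_nonneg (fun k _ => n4 i j k)).1 z2 k (Finset.mem_univ _)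
  have z4 := (Finset.sum_eq_zero_iff_of_nonneg (fun l _ => mul_self_nonneg (w i j k l))).1 z3 l (Finset.mem_univ _)
  have := mul_self_eq_zero.1 z4
  simp only [hw] at this
  exact sub_eq_zero.1 this

/-- Linearised Riemann tensor of a polynomial tensor. -/
def Rie (p : ι → ι → MvPolynomial ι ℝ) (i j k l : ι) : MvPolynomial ι ℝ :=
  pderiv j (pderiv k (p i l)) - pderiv i (pderiv k (p j l))
      - pderiv j (pderiv l (p i k)) + pderiv i (pderiv l (p j k))

theorem weyl_poly (hn : 4 ≤ Fintype.card ι) (p : ι → ι → MvPolynomial ι ℝ)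
    (hp : ∀ i k, p i k = p k i)
    (hW : ∀ w : ι → ι → ι → ι → ℝ, IsW w → ∀ x : ι → ℝ, ∑ i, ∑ j, ∑ k, ∑ l, w i j k l * eval x (pderiv j (pderiv k (p i l))) = 0) :
    ∃ A : ι → ι → MvPolynomial ι ℝ, (∀ i k, A i k = A k i) ∧ ∀ i j k l,
      Rie p i j k l = A i k * dl j l + A j l * dl i k - A i l * dl j k - A j k * dl i l := by
  have r1 : ∀ i j k l, Rie p j i k l = - Rie p i j k l := by intro i j k l; unfold Rie; ring
  have r2 : ∀ i j k l, Rie p i j l k = - Rie p i j k l := by intro i j k l; unfold Rie; ring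
  have r3 : ∀ i j k l, Rie p k l i j = Rie p i j k l := by
    intro i j k l; unfold Rie
    rw [hp k j, hp l j, hp k i, hp l i, pderiv_comm' l i, pderiv_comm' k i, pderiv_comm' l j, pderiv_comm' k j]; ring
  set A : ι → ι → MvPolynomial ι ℝ := fun j l => C (1 / ((Fintype.card ι : ℝ) - 2)) * ((∑ i, Rie p i j i l) - C (1 / (2 * ((Fintype.card ι : ℝ) - 1))) * (∑ i, ∑ k, Rie p i k i k) * dl j l) with hA
  refine ⟨A, ?_, ?_⟩
  · intro j l
    simp only [hA]
    have : ∑ i, Rie p i j i l = ∑ i, Rie p i l i j := Finset.sum_congr rfl fun i _ => r3 i l i j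
    rw [this]
    simp only [dl, eq_comm]
  intro i j k l
  apply MvPolynomial.funext
  intro x
  have hdl : ∀ i j : ι, eval x (dl i j : MvPolynomial ι ℝ) = if i = j then 1 else 0 := by
    intro i j; unfold dl; split_ifs <;> simp
  have := weyl_alg hn (fun i j k l => eval x (Rie p i j k l)) 
    (fun i j k l => by simp only [r1 i j k l, map_neg]) (fun i j k l => by simp only [r2 i j k l, map_neg])
    (fun i j k l => by simp only [r3 i j k l]) (fun j l => eval x (A j l))
    (fun j l => by 
      simp only [hA, map_mul, map_sub, map_sum, eval_C, hdl]; ring) ?_ i j k l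
  · simp only [map_sub, map_add, map_mul, hdl]
    exact this
  · intro w hw
    have h0 := hW w hw x
    have s1 : ∑ i, ∑ j, ∑ k, ∑ l, w i j k l * eval x (pderiv i (pderiv k (p j l))) = 0 := by
      rw [Finset.sum_comm, ← neg_eq_zero, ← h0, ← Finset.sum_neg_distrib]
      refine Finset.sum_congr rfl fun i _ => ?_
      rw [← Finset.sum_neg_distrib]
      refine Finset.sum_congr rfl fun j _ => ?_
      rw [← Finset.sum_neg_distrib]
      refine Finset.sum_congr rfl fun k _ => ?_
      rw [← Finset.sum_neg_distrib]
      refine Finset.sum_congr rfl fun l _ => ?_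
      rw [hw.a1 i j k l]; ring
    have s0 : ∀ f : ι → ι → ι → ι → ℝ, (∑ i, ∑ j, ∑ k, ∑ l, w i j k l * f i j k l) = 0 → ∑ i, ∑ j, ∑ k, ∑ l, w i j k l * f i j l k = 0 := by
      intro f hf
      rw [← neg_eq_zero, ← hf, ← Finset.sum_neg_distrib]
      refine Finset.sum_congr rfl fun i _ => ?_
      rw [← Finset.sum_neg_distrib]
      refine Finset.sum_congr rfl fun j _ => ?_
      rw [Finset.sum_comm, ← Finset.sum_neg_distrib]
      refine Finset.sum_congr rfl fun k _ => ?_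
      rw [← Finset.sum_neg_distrib]
      refine Finset.sum_congr rfl fun l _ => ?_
      rw [hw.a2 i j k l]; ring
    have s2 := s0 (fun i j k l => eval x (pderiv j (pderiv k (p i l)))) h0
    have s3 := s0 (fun i j k l => eval x (pderiv i (pderiv k (p j l)))) s1
    simp only [Rie, map_sub, map_add, mul_sub, mul_add, Finset.sum_sub_distrib, Finset.sum_add_distrib] at *
    rw [h0, s1, s2, s3]; ring
end alg3
end S5

namespace S5
open MvPolynomial
section alg4
variable {ι : Type} [Fintype ι] [DecidableEq ι]

/-- Restriction to `x_{l₀} = 0`. -/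
def rho (l₀ : ι) : MvPolynomial ι ℝ →ₐ[ℝ] MvPolynomial ι ℝ := aeval (fun i => if i = l₀ then 0 else X i)

theorem rho_X (l₀ i : ι) : rho l₀ (X i) = if i = l₀ then 0 else X i := by simp [rho]

theorem eval_rho (l₀ : ι) (y : ι → ℝ) (q : MvPolynomial ι ℝ) :
    eval y (rho l₀ q) = eval (Function.update y l₀ 0) q := by
  induction q using MvPolynomial.induction_on with
  | C a => simp [rho]
  | add p q hp hq => simp [hp, hq]
  | mul_X p j hp =>
    rw [map_mul, map_mul, map_mul, hp, rho_X, eval_X]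
    split_ifs with h
    · subst h; simp
    · simp [h]

theorem rho_pderiv (l₀ i : ι) (hi : i ≠ l₀) (q : MvPolynomial ι ℝ) :
    rho l₀ (pderiv i q) = pderiv i (rho l₀ q) := by
  induction q using MvPolynomial.induction_on with
  | C a => simp [rho]
  | add p q hp hq => simp [hp, hq]
  | mul_X p j hp =>
    rw [pderiv_mul, map_add, map_mul, map_mul, map_mul, pderiv_mul, hp, rho_X]
    congr 2
    by_cases h : j = l₀
    · subst h; rw [pderiv_X_of_ne hi.symm]; simp
    · rw [if_neg h]
      by_cases h' : j = i
      · subst h'; simp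
      · rw [pderiv_X_of_ne h', map_zero]

theorem rho_coeff (l₀ : ι) (q : MvPolynomial ι ℝ) (α : ι →₀ ℕ) (hα : α l₀ = 0) :
    coeff α (rho l₀ q) = coeff α q := by
  induction q using MvPolynomial.induction_on generalizing α with
  | C a => simp [rho]
  | add p q hp hq => simp [hp α hα, hq α hα]
  | mul_X p j hp =>
    rw [map_mul, rho_X]
    split_ifs with h
    · subst h
      rw [coeff_mul_X', if_neg (by simpa using hα)]; simp
    · rw [coeff_mul_X', coeff_mul_X']
      split_ifs with h'
      · apply hp
        simp [hα]
      · rfl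

/-- Vanishing to order `s` in `x_{l₀}`. -/
def ZZ (l₀ : ι) (s : ℕ) (q : MvPolynomial ι ℝ) : Prop := ∀ α : ι →₀ ℕ, α l₀ < s → coeff α q = 0

theorem ZZ.add {l₀ : ι} {s : ℕ} {p q : MvPolynomial ι ℝ} (hp : ZZ l₀ s p) (hq : ZZ l₀ s q) : ZZ l₀ s (p + q) :=
  fun α h => by rw [coeff_add, hp α h, hq α h, add_zero]
theorem ZZ.neg {l₀ : ι} {s : ℕ} {p : MvPolynomial ι ℝ} (hp : ZZ l₀ s p) : ZZ l₀ s (-p) :=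
  fun α h => by rw [coeff_neg, hp α h, neg_zero]
theorem ZZ.sub {l₀ : ι} {s : ℕ} {p q : MvPolynomial ι ℝ} (hp : ZZ l₀ s p) (hq : ZZ l₀ s q) : ZZ l₀ s (p - q) :=
  fun α h => by rw [coeff_sub, hp α h, hq α h, sub_zero]
theorem ZZ.sum {l₀ : ι} {s : ℕ} {τ : Type} (t : Finset τ) {p : τ → MvPolynomial ι ℝ} (hp : ∀ i ∈ t, ZZ l₀ s (p i)) :
    ZZ l₀ s (∑ i ∈ t, p i) :=
  fun α h => by rw [coeff_sum]; exact Finset.sum_eq_zero fun i hi => hp i hi α h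
theorem ZZ.of_C_mul {l₀ : ι} {s : ℕ} {c : ℝ} (hc : c ≠ 0) {p : MvPolynomial ι ℝ} (hp : ZZ l₀ s (C c * p)) : ZZ l₀ s p :=
  fun α h => by
    have := hp α h
    rw [coeff_C_mul] at this
    exact (mul_eq_zero.1 this).resolve_left hc
theorem ZZ.pderiv {l₀ : ι} {s : ℕ} {p : MvPolynomial ι ℝ} (hp : ZZ l₀ s p) {i : ι} (hi : i ≠ l₀) :
    ZZ l₀ s (pderiv i p) := fun α h => by
  rw [coeff_pderiv, hp _ (by rw [Finsupp.add_apply, Finsupp.single_eq_of_ne hi.symm]; simpa using h), zero_mul]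
theorem ZZ.up {l₀ : ι} {s : ℕ} {p : MvPolynomial ι ℝ} (h1 : ZZ l₀ 1 p) (hp : ZZ l₀ s (MvPolynomial.pderiv l₀ p)) :
    ZZ l₀ (s + 1) p := fun α h => by
  by_cases h0 : α l₀ = 0
  · exact h1 α (by omega)
  have := hp (α - Finsupp.single l₀ 1) (by simp; omega)
  rw [coeff_pderiv, tsub_add_cancel_of_le (by simpa using Nat.one_le_iff_ne_zero.2 h0)] at this
  refine (mul_eq_zero.1 this).resolve_right ?_
  positivity
theorem ZZ.down {l₀ : ι} {s : ℕ} {p : MvPolynomial ι ℝ} (hp : ZZ l₀ (s + 1) p) : ZZ l₀ s (MvPolynomial.pderiv l₀ p) :=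
  fun α h => by rw [coeff_pderiv, hp _ (by simpa using h), zero_mul]

theorem ex_ne (hn : 5 ≤ Fintype.card ι) (a b c d : ι) : ∃ j, j ≠ a ∧ j ≠ b ∧ j ≠ c ∧ j ≠ d := by
  have : ∃ j, j ∉ ({a, b, c, d} : Finset ι) := by
    by_contra! h
    have h1 : (Finset.univ : Finset ι) ⊆ {a, b, c, d} := fun x _ => h x
    have := Finset.card_le_card h1
    have h3 := Finset.card_le_four (a := a) (b := b) (c := c) (d := d)
    rw [Finset.card_univ] at this
    omega
  simpa using this

theorem cauchy_step (hn : 5 ≤ Fintype.card ι) (l₀ : ι) (p A : ι → ι → MvPolynomial ι ℝ)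
    (hp : ∀ i k, p i k = p k i) (hl : ∀ i, p i l₀ = 0) (htr : ∑ i, p i i = 0)
    (hR : ∀ i j k l, Rie p i j k l = A i k * dl j l + A j l * dl i k - A i l * dl j k - A j k * dl i l)
    (s : ℕ) (h1 : ∀ i k, ZZ l₀ 2 (p i k)) (hs : ∀ i k, ZZ l₀ s (p i k)) (i k : ι) : ZZ l₀ (s + 2) (p i k) := by
  have d1 : ∀ i : ι, (dl i i : MvPolynomial ι ℝ) = 1 := fun i => if_pos rfl
  have d0 : ∀ i j : ι, i ≠ j → (dl i j : MvPolynomial ι ℝ) = 0 := fun i j h => if_neg h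
  have hl' : ∀ i, p l₀ i = 0 := fun i => by rw [hp, hl]
  have zR : ∀ i j k l, i ≠ l₀ → j ≠ l₀ → k ≠ l₀ → l ≠ l₀ → ZZ l₀ s (Rie p i j k l) := by
    intro i j k l hi hj hk hl
    exact ((((hs _ _).pderiv hk).pderiv hj |>.sub (((hs _ _).pderiv hk).pderiv hi)).sub (((hs _ _).pderiv hl).pderiv hj)).add (((hs _ _).pderiv hl).pderiv hi)
  have zA : ∀ j l, j ≠ l₀ → l ≠ l₀ → j ≠ l → ZZ l₀ s (A j l) := by
    intro j l hj hl hjl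
    obtain ⟨i, h1, h2, h3, -⟩ := ex_ne hn j l l₀ l₀
    have := zR i j i l h3 hj h3 hl
    rw [hR, d1, d0 j l hjl, d0 j i h1.symm, d0 i l h2] at this
    simpa using this
  have zAA : ∀ i j, i ≠ l₀ → j ≠ l₀ → i ≠ j → ZZ l₀ s (A i i + A j j) := by
    intro i j hi hj hij
    have := zR i j i j hi hj hi hj
    rw [hR, d1, d1, d0 j i hij.symm, d0 i j hij] at this
    simpa using this
  have zB : ∀ i, i ≠ l₀ → ZZ l₀ s (A i i) := by
    intro i hi
    obtain ⟨j, j1, j2, -, -⟩ := ex_ne hn i l₀ l₀ l₀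
    obtain ⟨k, k1, k2, k3, -⟩ := ex_ne hn i j l₀ l₀
    have := ((zAA i j hi j2 j1.symm).add (zAA i k hi k3 k1.symm)).sub (zAA j k j2 k3 k2.symm)
    have e : A i i + A j j + (A i i + A k k) - (A j j + A k k) = C 2 * A i i := by
      rw [show (C (2:ℝ) : MvPolynomial ι ℝ) = 2 from rfl]; ring
    rw [e] at this
    exact this.of_C_mul (by norm_num)
  have hN : ∀ j l, j ≠ l₀ → l ≠ l₀ → - pderiv l₀ (pderiv l₀ (p j l)) = A j l + A l₀ l₀ * dl j l := by
    intro j l hj hl2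
    have := hR l₀ j l₀ l
    rw [d1, d0 j l₀ hj, d0 l₀ l hl2.symm] at this
    unfold Rie at this
    rw [hl, hl', hl] at this
    simp only [map_zero] at this
    linear_combination this
  have zN : ZZ l₀ s (A l₀ l₀) := by
    have e : ∑ j ∈ Finset.univ.erase l₀, - pderiv l₀ (pderiv l₀ (p j j)) = 0 := by
      have h0 : ∑ j, - pderiv l₀ (pderiv l₀ (p j j)) = 0 := by
        rw [Finset.sum_neg_distrib, ← map_sum, ← map_sum, htr]; simp
      rw [← Finset.add_sum_erase _ _ (Finset.mem_univ l₀), hl] at h0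
      simpa using h0
    have e2 : ∑ j ∈ Finset.univ.erase l₀, - pderiv l₀ (pderiv l₀ (p j j)) = ∑ j ∈ Finset.univ.erase l₀, (A j j + A l₀ l₀) := by
      refine Finset.sum_congr rfl fun j hj => ?_
      have hj' := Finset.ne_of_mem_erase hj
      rw [hN j j hj' hj', d1, mul_one]
    rw [e, Finset.sum_add_distrib, Finset.sum_const, Finset.card_erase_of_mem (Finset.mem_univ _), Finset.card_univ, nsmul_eq_mul] at e2
    have e3 : C (((Fintype.card ι - 1 : ℕ) : ℝ)) * A l₀ l₀ = - ∑ j ∈ Finset.univ.erase l₀, A j j := by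
      rw [map_natCast]; linear_combination -e2
    apply ZZ.of_C_mul (c := ((Fintype.card ι - 1 : ℕ) : ℝ)) (by
      have : Fintype.card ι - 1 ≠ 0 := by omega
      exact_mod_cast this)
    rw [e3]
    exact (ZZ.sum _ fun j hj => zB j (Finset.ne_of_mem_erase hj)).neg
  by_cases hi : i = l₀
  · subst hi; rw [hl']; intro α _; simp
  by_cases hk : k = l₀
  · subst hk; rw [hl]; intro α _; simp
  have z2 : ZZ l₀ s (pderiv l₀ (pderiv l₀ (p i k))) := by
    have e : pderiv l₀ (pderiv l₀ (p i k)) = - (A i k + A l₀ l₀ * dl i k) := by rw [← hN i k hi hk, neg_neg]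
    rw [e]
    by_cases hik : i = k
    · subst hik; rw [d1, mul_one]; exact ((zB i hi).add zN).neg
    · rw [d0 i k hik, mul_zero, add_zero]; exact (zA i k hi hk hik).neg
  have z3 := (h1 i k).down
  exact ZZ.up (fun α h => h1 i k α (by omega)) (ZZ.up z3 z2)

theorem alg_main (hn : 6 ≤ Fintype.card ι) (l₀ : ι) (p : ι → ι → MvPolynomial ι ℝ)
    (hp : ∀ i k, p i k = p k i) (hl : ∀ i, p i l₀ = 0) (htr : ∑ i, p i i = 0)
    (hx : ∀ x : ι → ℝ, x l₀ = 0 → ∀ i, ∑ k, eval x (p i k) * x k = 0)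
    (hd : ∀ x : ι → ℝ, x l₀ = 0 → ∀ i k, eval x (pderiv l₀ (p i k)) = 0)
    (hW : ∀ w : ι → ι → ι → ι → ℝ, IsW w → ∀ x : ι → ℝ, ∑ i, ∑ j, ∑ k, ∑ l, w i j k l * eval x (pderiv j (pderiv k (p i l))) = 0)
    (i k : ι) : p i k = 0 := by
  obtain ⟨A, hA, hR⟩ := weyl_poly (by omega) p hp hW
  have hl' : ∀ i, p l₀ i = 0 := fun i => by rw [hp, hl]
  have hsplit : ∀ f : ι → MvPolynomial ι ℝ, f l₀ = 0 → ∑ i : {i // i ≠ l₀}, f i = ∑ i, f i := by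
    intro f hf
    rw [← Finset.add_sum_erase _ _ (Finset.mem_univ l₀), hf, zero_add]
    symm
    apply Finset.sum_subtype
    simp
  have tz : ∀ i k : {i // i ≠ l₀}, rho l₀ (p i k) = 0 := by
    apply tang_zero (fun i : {i // i ≠ l₀} => (i : ι)) Subtype.val_injective
      (by rw [Fintype.card_subtype_compl]; simp; omega)
      (fun i k => rho l₀ (p i k)) (fun i k => rho l₀ (A i k))
    · intro i k; rw [hp]
    · intro i k; rw [hA]
    · rw [hsplit (fun i => rho l₀ (p i i)) (by simp [hl]), ← map_sum, htr, map_zero]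
    · intro i
      rw [hsplit (fun k => rho l₀ (p i k) * X k) (by simp [hl])]
      apply MvPolynomial.funext
      intro y
      simp only [map_sum, map_mul, eval_rho, eval_X, map_zero]
      have := hx (Function.update y l₀ 0) (by simp) i
      refine Eq.trans ?_ this
      refine Finset.sum_congr rfl fun k _ => ?_
      by_cases hk : k = l₀
      · subst hk; rw [hl]; simp
      · rw [Function.update_of_ne hk]
    · intro i j k l
      have := congrArg (rho l₀) (hR i j k l)
      have hdl : ∀ i j : {i // i ≠ l₀}, rho l₀ (dl (i : ι) (j : ι)) = dl i j := by
        intro i j; unfold dl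
        by_cases h : i = j
        · simp [h]
        · rw [if_neg h, if_neg (fun h' => h (Subtype.ext h')), map_zero]
      simp only [Rie, map_add, map_sub, map_mul, hdl, rho_pderiv l₀ _ i.2, rho_pderiv l₀ _ j.2, rho_pderiv l₀ _ k.2, rho_pderiv l₀ _ l.2] at this
      exact this
  have z1 : ∀ i k, ZZ l₀ 1 (p i k) := by
    intro i k
    by_cases hi : i = l₀
    · subst hi; rw [hl']; intro α _; simp
    by_cases hk : k = l₀
    · subst hk; rw [hl]; intro α _; simp
    intro α hα
    rw [← rho_coeff l₀ _ α (by omega), tz ⟨i, hi⟩ ⟨k, hk⟩, coeff_zero]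
  have z2 : ∀ i k, ZZ l₀ 2 (p i k) := by
    intro i k
    apply ZZ.up (z1 i k)
    intro α hα
    have : rho l₀ (pderiv l₀ (p i k)) = 0 := by
      apply MvPolynomial.funext
      intro y
      rw [eval_rho, hd _ (by simp), map_zero]
    rw [← rho_coeff l₀ _ α (by omega), this, coeff_zero]
  have zs : ∀ s : ℕ, ∀ i k, ZZ l₀ s (p i k) := by
    intro s
    induction s with
    | zero => intro i k α h; omega
    | succ s ih =>
      intro i k α h
      exact cauchy_step (by omega) l₀ p A hp hl htr hR s z2 ih i k α (by omega)
  ext α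
  rw [zs (α l₀ + 1) i k α (by omega), coeff_zero]
end alg4
end S5

namespace S5
open MvPolynomial
section fn
variable {n : ℕ}

/-- Polynomial function on Euclidean space. -/
def fe (p : MvPolynomial (Fin n) ℝ) : Euc n → ℝ := fun x => eval x.ofLp p

theorem fe_C (c : ℝ) : fe (C c : MvPolynomial (Fin n) ℝ) = fun _ => c := by
  funext x; simp [fe]
theorem fe_add (p q : MvPolynomial (Fin n) ℝ) : fe (p + q) = fun x => fe p x + fe q x := by
  funext x; simp [fe]
theorem fe_mul_X (p : MvPolynomial (Fin n) ℝ) (i : Fin n) : fe (p * X i) = fun x => fe p x * x i := by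
  funext x; simp [fe]

theorem contDiff_coord (i : Fin n) : ContDiff ℝ (⊤ : ℕ∞) (fun x : Euc n => x i) := by
  fun_prop

theorem fe_smooth (p : MvPolynomial (Fin n) ℝ) : ContDiff ℝ (⊤ : ℕ∞) (fe p) := by
  induction p using MvPolynomial.induction_on with
  | C a => rw [fe_C]; exact contDiff_const
  | add p q hp hq => rw [fe_add]; exact hp.add hq
  | mul_X p i hp => rw [fe_mul_X]; exact hp.mul (contDiff_coord i)

theorem sm_diff {f : Euc n → ℝ} (hf : ContDiff ℝ (⊤ : ℕ∞) f) (x) : DifferentiableAt ℝ f x :=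
  (hf.differentiable (by simp)) x

theorem pd_smooth {f : Euc n → ℝ} (hf : ContDiff ℝ (⊤ : ℕ∞) f) (i : Fin n) : ContDiff ℝ (⊤ : ℕ∞) (pd i f) := by
  unfold pd
  have : ContDiff ℝ (⊤ : ℕ∞) (fderiv ℝ f) := hf.fderiv_right (by simp)
  exact this.clm_apply contDiff_const

theorem pd_add {f g : Euc n → ℝ} {x} (hf : DifferentiableAt ℝ f x) (hg : DifferentiableAt ℝ g x) (i : Fin n) :
    pd i (fun x => f x + g x) x = pd i f x + pd i g x := by
  unfold pd; rw [fderiv_fun_add hf hg]; rfl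
theorem pd_sub {f g : Euc n → ℝ} {x} (hf : DifferentiableAt ℝ f x) (hg : DifferentiableAt ℝ g x) (i : Fin n) :
    pd i (fun x => f x - g x) x = pd i f x - pd i g x := by
  unfold pd; rw [fderiv_fun_sub hf hg]; rfl
theorem pd_mul {f g : Euc n → ℝ} {x} (hf : DifferentiableAt ℝ f x) (hg : DifferentiableAt ℝ g x) (i : Fin n) :
    pd i (fun x => f x * g x) x = f x * pd i g x + pd i f x * g x := by
  unfold pd; rw [fderiv_fun_mul hf hg]; simp; ring
theorem pd_const (c : ℝ) (i : Fin n) (x) : pd i (fun _ => c) x = 0 := by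
  unfold pd; simp
theorem pd_coord (i j : Fin n) (x : Euc n) : pd i (fun x => x j) x = kd i j := by
  unfold pd
  have : (fun x : Euc n => x j) = (EuclideanSpace.proj j : Euc n →L[ℝ] ℝ) := rfl
  rw [this, ContinuousLinearMap.fderiv]
  simp [kd, EuclideanSpace.single_apply, eq_comm]

theorem pd_fe (i : Fin n) (p : MvPolynomial (Fin n) ℝ) : pd i (fe p) = fe (pderiv i p) := by
  induction p using MvPolynomial.induction_on with
  | C a => rw [fe_C]; funext x; rw [pd_const]; simp [fe]
  | add p q hp hq =>
    rw [fe_add, map_add, fe_add]; funext x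
    rw [pd_add (sm_diff (fe_smooth p) x) (sm_diff (fe_smooth q) x), hp, hq]
  | mul_X p j hp =>
    rw [fe_mul_X]; funext x
    rw [pd_mul (sm_diff (fe_smooth p) x) (sm_diff (contDiff_coord j) x), hp, pd_coord]
    simp [fe, pderiv_X, Pi.single_apply, kd]
    by_cases h : i = j
    · subst h; simp; ring
    · simp [h, Ne.symm h]; ring

theorem pd_comm {f : Euc n → ℝ} (hf : ContDiff ℝ (⊤ : ℕ∞) f) (i j : Fin n) (x) :
    pd i (pd j f) x = pd j (pd i f) x := by
  have hs : IsSymmSndFDerivAt ℝ f x := by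
    apply ContDiffAt.isSymmSndFDerivAt (n := (⊤ : ℕ∞)) hf.contDiffAt
    simp only [minSmoothness_of_isRCLikeNormedField]
    exact WithTop.coe_le_coe.2 (le_top : (2 : ℕ∞) ≤ ⊤)
  have hd : DifferentiableAt ℝ (fderiv ℝ f) x := by
    have : ContDiff ℝ (⊤ : ℕ∞) (fderiv ℝ f) := hf.fderiv_right (by simp)
    exact this.differentiable (by simp) x
  have key : ∀ a b : Euc n, fderiv ℝ (fun y => fderiv ℝ f y a) x b = fderiv ℝ (fderiv ℝ f) x b a := by
    intro a b
    rw [fderiv_clm_apply hd (by fun_prop)]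
    simp
  unfold pd
  rw [key, key]
  exact hs _ _

theorem fe_zero_of_open (p : MvPolynomial (Fin n) ℝ) (U : Set (Euc n)) (hU : IsOpen U) (hne : U.Nonempty)
    (h : ∀ x ∈ U, fe p x = 0) : p = 0 := by
  obtain ⟨x₀, hx₀⟩ := hne
  have han : AnalyticOnNhd ℝ (fe p) Set.univ := by
    have h1 := AnalyticOnNhd.eval_mvPolynomial (𝕜 := ℝ) p
    intro x _
    have h2 : AnalyticAt ℝ (fun x : Euc n => x.ofLp) x := (EuclideanSpace.equiv (Fin n) ℝ).toContinuousLinearMap.analyticAt x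
    exact AnalyticAt.comp (g := fun x => eval x p) (f := fun x : Euc n => x.ofLp) (h1 _ (Set.mem_univ _)) h2
  have h0 : Set.EqOn (fe p) 0 Set.univ := by
    apply han.eqOn_zero_of_preconnected_of_eventuallyEq_zero isPreconnected_univ (Set.mem_univ x₀)
    filter_upwards [hU.mem_nhds hx₀] with x hx using h x hx
  apply MvPolynomial.funext
  intro y
  have := h0 (Set.mem_univ (WithLp.toLp 2 y))
  simpa [fe] using this
end fn
end S5

namespace S5
open MvPolynomial
section walg
variable {n : ℕ}
/-- Full contraction. -/
def ctr (w f : Fin n → Fin n → Fin n → Fin n → ℝ) : ℝ := ∑ i, ∑ j, ∑ k, ∑ l, w i j k l * f i j k l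

theorem ctr_add (w f g : Fin n → Fin n → Fin n → Fin n → ℝ) :
    ctr w (fun i j k l => f i j k l + g i j k l) = ctr w f + ctr w g := by
  simp only [ctr, mul_add, Finset.sum_add_distrib]
theorem ctr_sub (w f g : Fin n → Fin n → Fin n → Fin n → ℝ) :
    ctr w (fun i j k l => f i j k l - g i j k l) = ctr w f - ctr w g := by
  simp only [ctr, mul_sub, Finset.sum_sub_distrib]

theorem ctr_ij {w} (hw : IsW w) (f : Fin n → Fin n → Fin n → Fin n → ℝ) (h : ∀ i j k l, f i j k l = f j i k l) :
    ctr w f = 0 := by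
  have : ctr w f = - ctr w f := by
    conv_lhs => rw [ctr, Finset.sum_comm]
    simp only [ctr, ← Finset.sum_neg_distrib]
    refine Finset.sum_congr rfl fun i _ => Finset.sum_congr rfl fun j _ => Finset.sum_congr rfl fun k _ => Finset.sum_congr rfl fun l _ => ?_
    rw [hw.a1, h]; ring
  linarith
theorem ctr_kl {w} (hw : IsW w) (f : Fin n → Fin n → Fin n → Fin n → ℝ) (h : ∀ i j k l, f i j k l = f i j l k) :
    ctr w f = 0 := by
  have : ctr w f = - ctr w f := by
    conv_lhs => rw [ctr]
    simp only [ctr, ← Finset.sum_neg_distrib]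
    refine Finset.sum_congr rfl fun i _ => Finset.sum_congr rfl fun j _ => ?_
    rw [Finset.sum_comm]
    refine Finset.sum_congr rfl fun k _ => Finset.sum_congr rfl fun l _ => ?_
    rw [hw.a2, h]; ring
  linarith
theorem ctr_swap_ij {w} (hw : IsW w) (f : Fin n → Fin n → Fin n → Fin n → ℝ) :
    ctr w f = - ctr w (fun i j k l => f j i k l) := by
  conv_lhs => rw [ctr, Finset.sum_comm]
  simp only [ctr, ← Finset.sum_neg_distrib]
  refine Finset.sum_congr rfl fun i _ => Finset.sum_congr rfl fun j _ => Finset.sum_congr rfl fun k _ => Finset.sum_congr rfl fun l _ => ?_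
  rw [hw.a1]; ring
theorem ctr_swap_kl {w} (hw : IsW w) (f : Fin n → Fin n → Fin n → Fin n → ℝ) :
    ctr w f = - ctr w (fun i j k l => f i j l k) := by
  conv_lhs => rw [ctr]
  simp only [ctr, ← Finset.sum_neg_distrib]
  refine Finset.sum_congr rfl fun i _ => Finset.sum_congr rfl fun j _ => ?_
  rw [Finset.sum_comm]
  refine Finset.sum_congr rfl fun k _ => Finset.sum_congr rfl fun l _ => ?_
  rw [hw.a2]; ring
theorem ctr_ik {w} (hw : IsW w) (f : Fin n → Fin n → ℝ) :
    ctr w (fun i j k l => f j l * kd i k) = 0 := by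
  have h1 : ∀ i j, (∑ k, ∑ l, w i j k l * (f j l * kd i k)) = ∑ l, w i j i l * f j l := by
    intro i j
    rw [Finset.sum_eq_single i]
    · simp [kd]
    · intro b _ hb; simp [kd, Ne.symm hb]
    · simp
  simp only [ctr, h1]
  rw [Finset.sum_comm]
  refine Finset.sum_eq_zero fun j _ => ?_
  rw [Finset.sum_comm]
  refine Finset.sum_eq_zero fun l _ => ?_
  rw [← Finset.sum_mul, hw.tr, zero_mul]
theorem ctr_jk {w} (hw : IsW w) (f : Fin n → Fin n → ℝ) :
    ctr w (fun i j k l => f i l * kd j k) = 0 := by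
  rw [ctr_swap_ij hw, ctr_ik hw, neg_zero]
theorem ctr_il {w} (hw : IsW w) (f : Fin n → Fin n → ℝ) :
    ctr w (fun i j k l => f j k * kd i l) = 0 := by
  rw [ctr_swap_kl hw, ctr_ik hw, neg_zero]
theorem ctr_jl {w} (hw : IsW w) (f : Fin n → Fin n → ℝ) :
    ctr w (fun i j k l => f i k * kd j l) = 0 := by
  rw [ctr_swap_kl hw, ctr_jk hw, neg_zero]
theorem kd_comm (i j : Fin n) : kd i j = kd j i := by simp [kd, eq_comm]

theorem ctr_alg {w} (hw : IsW w) (t2 : Fin n → Fin n → Fin n → Fin n → ℝ) (t1 : Fin n → Fin n → Fin n → ℝ)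
    (t : Fin n → Fin n → ℝ) (a : Fin n → ℝ) (c : ℝ) (s : Fin n → Fin n → ℝ) (e : Fin n → ℝ)
    (ht : ∀ i j, t i j = t j i) (ht1 : ∀ j i k, t1 j i k = t1 j k i) :
    ctr w (fun i j k l => (t2 j k i l - ((a j * a i - c * kd j i) * t l k + a i * t1 j l k)
        - ((a j * a l - c * kd j l) * t i k + a l * t1 j i k) + s j i * kd l k + s j l * kd i k)
        + a l * (t1 j i k - a i * t k j - a k * t i j + e i * kd k j + e k * kd i j))
      = ctr w (fun i j k l => t2 j k i l) := by
  have e0 : (fun i j k l => (t2 j k i l - ((a j * a i - c * kd j i) * t l k + a i * t1 j l k)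
        - ((a j * a l - c * kd j l) * t i k + a l * t1 j i k) + s j i * kd l k + s j l * kd i k)
        + a l * (t1 j i k - a i * t k j - a k * t i j + e i * kd k j + e k * kd i j))
      = fun i j k l => t2 j k i l - (a j * a i - c * kd j i) * t l k - (a i * t1 j l k + a l * a k * t i j)
        - a l * (a j * t i k + a i * t k j) + (c * t i k) * kd j l + (s j i * kd l k) + s j l * kd i k
        + (a l * e i) * kd j k + (a l * e k * kd i j) := by
    funext i j k l; rw [kd_comm k j]; ring
  rw [e0]
  rw [ctr_add, ctr_add, ctr_add, ctr_add, ctr_add, ctr_sub, ctr_sub, ctr_sub]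
  rw [ctr_ij hw (fun i j k l => (a j * a i - c * kd j i) * t l k) (by intro i j k l; rw [kd_comm]; ring)]
  rw [ctr_kl hw (fun i j k l => (a i * t1 j l k + a l * a k * t i j)) (by intro i j k l; rw [ht1]; ring)]
  rw [ctr_ij hw (fun i j k l => a l * (a j * t i k + a i * t k j)) (by intro i j k l; rw [ht k j, ht k i]; ring)]
  rw [ctr_jl hw (fun i k => c * t i k), ctr_kl hw (fun i j k l => s j i * kd l k) (by intro i j k l; rw [kd_comm])]
  rw [ctr_ik hw, ctr_jk hw (fun i l => a l * e i), ctr_ij hw (fun i j k l => a l * e k * kd i j) (by intro i j k l; rw [kd_comm])]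
  ring
end walg

section ident
variable {n : ℕ}

/-- log-derivative coefficients. -/
def av (ε : ℝ) (i : Fin n) : Euc n → ℝ := fun x => -2 * x i / (ε ^ 2 + ‖x‖ ^ 2)

/-- normalized Q. -/
def Dop (ε : ℝ) (T : Fin n → Fin n → Euc n → ℝ) (i k l : Fin n) : Euc n → ℝ := fun x =>
  pd l (T i k) x - av ε i x * T k l x - av ε k x * T i l x + (∑ p, av ε p x * T i p x) * kd k l
    + (∑ p, av ε p x * T k p x) * kd i l

theorem rho_pos {ε : ℝ} (hε : 0 < ε) (x : Euc n) : 0 < ε ^ 2 + ‖x‖ ^ 2 := by positivity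

theorem nsq_smooth : ContDiff ℝ (⊤ : ℕ∞) (fun x : Euc n => ‖x‖ ^ 2) := contDiff_norm_sq ℝ

theorem pd_nsq (i : Fin n) (x : Euc n) : pd i (fun x : Euc n => ‖x‖ ^ 2) x = 2 * x i := by
  unfold pd
  have : fderiv ℝ (fun x : Euc n => ‖x‖ ^ 2) x = 2 • innerSL ℝ x := by
    exact (hasStrictFDerivAt_norm_sq x).hasFDerivAt.fderiv
  rw [this]
  simp [EuclideanSpace.inner_single_right]

theorem av_smooth {ε : ℝ} (hε : 0 < ε) (i : Fin n) : ContDiff ℝ (⊤ : ℕ∞) (av ε i) := by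
  unfold av
  exact (contDiff_const.mul (contDiff_coord i)).div (contDiff_const.add nsq_smooth) (fun x => (rho_pos hε x).ne')

theorem pd_av {ε : ℝ} (hε : 0 < ε) (i j : Fin n) (x : Euc n) :
    pd j (av ε i) x = av ε j x * av ε i x - (2 / (ε ^ 2 + ‖x‖ ^ 2)) * kd j i := by
  have h1 : ∀ y, av ε i y * (ε ^ 2 + ‖y‖ ^ 2) = -2 * y i := by
    intro y; unfold av; field_simp [(rho_pos hε y).ne']
  have h2 := congrArg (fun f => pd j f x) (funext h1)
  simp only at h2
  have hs : ContDiff ℝ (⊤ : ℕ∞) (fun x : Euc n => ε ^ 2 + ‖x‖ ^ 2) := contDiff_const.add nsq_smooth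
  rw [pd_mul (sm_diff (av_smooth hε i) x) (sm_diff hs x), pd_mul (sm_diff contDiff_const x) (sm_diff (contDiff_coord i) x),
    pd_add (sm_diff contDiff_const x) (sm_diff nsq_smooth x), pd_const, pd_const, pd_nsq, pd_coord] at h2
  have hr := (rho_pos hε x).ne'
  have h3 : pd j (av ε i) x = (-2 * kd j i - av ε i x * (2 * x j)) / (ε ^ 2 + ‖x‖ ^ 2) := by
    rw [eq_div_iff hr]; linarith
  rw [h3]
  unfold av
  field_simp
  ring

theorem pd_uE {ε : ℝ} (hε : 0 < ε) (hn : 6 ≤ n) (i : Fin n) (x : Euc n) :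
    2 / ((n : ℝ) - 2) * pd i (uE n ε) x = uE n ε x * av ε i x := by
  have hn' : (6:ℝ) ≤ n := by exact_mod_cast hn
  have hr := (rho_pos hε x)
  have hs : ContDiff ℝ (⊤ : ℕ∞) (fun x : Euc n => ε ^ 2 + ‖x‖ ^ 2) := contDiff_const.add nsq_smooth
  have hg : DifferentiableAt ℝ (fun x : Euc n => ε / (ε ^ 2 + ‖x‖ ^ 2)) x :=
    sm_diff (contDiff_const.div hs (fun x => (rho_pos hε x).ne')) x
  have hgp : ε / (ε ^ 2 + ‖x‖ ^ 2) ≠ 0 := by positivity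
  have h1 : pd i (fun x : Euc n => ε / (ε ^ 2 + ‖x‖ ^ 2)) x = ε / (ε ^ 2 + ‖x‖ ^ 2) * av ε i x := by
    have e : ∀ y : Euc n, ε / (ε ^ 2 + ‖y‖ ^ 2) * (ε ^ 2 + ‖y‖ ^ 2) = ε := by
      intro y; field_simp [(rho_pos hε y).ne']
    have h2 := congrArg (fun f => pd i f x) (funext e)
    try simp only at h2
    rw [pd_mul hg (sm_diff hs x), pd_const, pd_add (sm_diff contDiff_const x) (sm_diff nsq_smooth x), pd_const, pd_nsq] at h2
    have h3 : pd i (fun x : Euc n => ε / (ε ^ 2 + ‖x‖ ^ 2)) x = (- (ε / (ε ^ 2 + ‖x‖ ^ 2) * (2 * x i))) / (ε ^ 2 + ‖x‖ ^ 2) := by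
      rw [eq_div_iff hr.ne']; linarith
    rw [h3]; unfold av; field_simp
  have h4 : pd i (uE n ε) x = (((n:ℝ) - 2) / 2) * (ε / (ε ^ 2 + ‖x‖ ^ 2)) ^ (((n : ℝ) - 2) / 2 - 1) * pd i (fun x : Euc n => ε / (ε ^ 2 + ‖x‖ ^ 2)) x := by
    have := (hg.hasFDerivAt.rpow_const (p := ((n : ℝ) - 2) / 2) (Or.inl hgp)).fderiv
    unfold pd uE
    rw [this]; rfl
  rw [h4, h1, Real.rpow_sub_one hgp]
  unfold uE
  have : (n:ℝ) - 2 ≠ 0 := by linarith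
  field_simp

theorem Qop_eq {ε : ℝ} (hε : 0 < ε) (hn : 6 ≤ n) (H : Fin n → Fin n → Euc n → ℝ) (V : Fin n → Euc n → ℝ)
    (i k l : Fin n) (x : Euc n) : Qop ε H V i k l x = uE n ε x * Dop ε (Tten H V) i k l x := by
  unfold Qop Dop
  have h1 : ∀ i, 2 / ((n : ℝ) - 2) * (∑ p, pd p (uE n ε) x * Tten H V i p x) = uE n ε x * ∑ p, av ε p x * Tten H V i p x := by
    intro i
    rw [Finset.mul_sum, Finset.mul_sum]
    refine Finset.sum_congr rfl fun p _ => ?_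
    rw [← mul_assoc, pd_uE hε hn, mul_assoc]
  rw [h1, h1, pd_uE hε hn, pd_uE hε hn]; ring

theorem Dop_ident {ε : ℝ} (hε : 0 < ε) {w} (hw : IsW w) (T : Fin n → Fin n → Euc n → ℝ)
    (hT : ∀ i k, ContDiff ℝ (⊤ : ℕ∞) (T i k)) (hs : ∀ i k, T i k = T k i) (x : Euc n) :
    ctr w (fun i j k l => pd j (Dop ε T i l k) x + av ε l x * Dop ε T i k j x)
      = ctr w (fun i j k l => pd j (pd k (T i l)) x) := by
  have hE : ∀ i, ContDiff ℝ (⊤ : ℕ∞) (fun x => ∑ p, av ε p x * T i p x) := fun i =>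
    ContDiff.sum fun p _ => (av_smooth hε p).mul (hT i p)
  rw [← ctr_alg hw (fun j k i l => pd j (pd k (T i l)) x) (fun j i k => pd j (T i k) x) (fun i k => T i k x)
    (fun i => av ε i x) (2 / (ε ^ 2 + ‖x‖ ^ 2)) (fun j i => pd j (fun x => ∑ p, av ε p x * T i p x) x)
    (fun i => ∑ p, av ε p x * T i p x) (by intro i j; rw [hs]) (by intro j i k; rw [hs])]
  congr 1
  funext i j k l
  have e1 : pd j (Dop ε T i l k) x = pd j (pd k (T i l)) x - ((av ε j x * av ε i x - 2 / (ε ^ 2 + ‖x‖ ^ 2) * kd j i) * T l k x + av ε i x * pd j (T l k) x)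
      - ((av ε j x * av ε l x - 2 / (ε ^ 2 + ‖x‖ ^ 2) * kd j l) * T i k x + av ε l x * pd j (T i k) x)
      + pd j (fun x => ∑ p, av ε p x * T i p x) x * kd l k + pd j (fun x => ∑ p, av ε p x * T l p x) x * kd i k := by
    unfold Dop
    have s1 := pd_smooth (hT i l) k
    have s2 := (av_smooth hε i).mul (hT l k)
    have s3 := (av_smooth hε l).mul (hT i k)
    have s4 : ContDiff ℝ (⊤ : ℕ∞) (fun x => (∑ p, av ε p x * T i p x) * kd l k) := (hE i).mul contDiff_const
    have s5 : ContDiff ℝ (⊤ : ℕ∞) (fun x => (∑ p, av ε p x * T l p x) * kd i k) := (hE l).mul contDiff_const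
    rw [pd_add (sm_diff (((s1.sub s2).sub s3).add s4) x) (sm_diff s5 x),
      pd_add (sm_diff ((s1.sub s2).sub s3) x) (sm_diff s4 x), pd_sub (sm_diff (s1.sub s2) x) (sm_diff s3 x),
      pd_sub (sm_diff s1 x) (sm_diff s2 x), pd_mul (sm_diff (av_smooth hε i) x) (sm_diff (hT l k) x),
      pd_mul (sm_diff (av_smooth hε l) x) (sm_diff (hT i k) x), pd_mul (sm_diff (hE i) x) (sm_diff contDiff_const x),
      pd_mul (sm_diff (hE l) x) (sm_diff contDiff_const x), pd_av hε, pd_av hε, pd_const, pd_const]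
    ring
  rw [e1]
  unfold Dop
  ring

theorem Sop_smooth (V : Fin n → Euc n → ℝ) (hV : ∀ i, ContDiff ℝ (⊤ : ℕ∞) (V i)) (i k : Fin n) :
    ContDiff ℝ (⊤ : ℕ∞) (Sop V i k) := by
  unfold Sop
  exact ((pd_smooth (hV k) i).add (pd_smooth (hV i) k)).sub ((contDiff_const.mul (ContDiff.sum fun m _ => pd_smooth (hV m) m)).mul contDiff_const)

theorem Sop_ident {w} (hw : IsW w) (V : Fin n → Euc n → ℝ) (hV : ∀ i, ContDiff ℝ (⊤ : ℕ∞) (V i)) (x : Euc n) :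
    ctr w (fun i j k l => pd j (pd k (Sop V i l)) x) = 0 := by
  have hdv : ContDiff ℝ (⊤ : ℕ∞) (fun x => (2 / (n : ℝ)) * (∑ m, pd m (V m) x)) :=
    contDiff_const.mul (ContDiff.sum fun m _ => pd_smooth (hV m) m)
  have e1 : ∀ i j k l, pd j (pd k (Sop V i l)) x = pd j (pd k (pd i (V l))) x + pd j (pd k (pd l (V i))) x
      - pd j (pd k (fun x => (2 / (n : ℝ)) * (∑ m, pd m (V m) x))) x * kd i l := by
    intro i j k l
    have f1 : pd k (Sop V i l) = fun x => pd k (pd i (V l)) x + pd k (pd l (V i)) x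
        - pd k (fun x => (2 / (n : ℝ)) * (∑ m, pd m (V m) x)) x * kd i l := by
      funext y
      unfold Sop
      rw [pd_sub (sm_diff ((pd_smooth (hV l) i).add (pd_smooth (hV i) l)) y) (sm_diff (hdv.mul contDiff_const) y),
        pd_add (sm_diff (pd_smooth (hV l) i) y) (sm_diff (pd_smooth (hV i) l) y),
        pd_mul (sm_diff hdv y) (sm_diff contDiff_const y), pd_const]
      ring
    rw [f1]
    have s1 := pd_smooth (pd_smooth (hV l) i) k
    have s2 := pd_smooth (pd_smooth (hV i) l) k
    have s3 := pd_smooth hdv k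
    rw [pd_sub (sm_diff (s1.add s2) x) (sm_diff (s3.mul contDiff_const) x), pd_add (sm_diff s1 x) (sm_diff s2 x),
        pd_mul (sm_diff s3 x) (sm_diff contDiff_const x), pd_const]
    ring
  simp only [e1]
  rw [ctr_sub, ctr_add]
  rw [ctr_ij hw (fun i j k l => pd j (pd k (pd i (V l))) x), ctr_kl hw (fun i j k l => pd j (pd k (pd l (V i))) x), ctr_il hw (fun j k => pd j (pd k (fun x => (2 / (n : ℝ)) * (∑ m, pd m (V m) x))) x)]
  · ring
  · intro i j k l
    have : pd k (pd l (V i)) = pd l (pd k (V i)) := funext fun y => pd_comm (hV i) _ _ y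
    rw [this]
  · intro i j k l
    have h1 : pd k (pd i (V l)) = pd i (pd k (V l)) := funext fun y => pd_comm (hV l) _ _ y
    have h2 : pd k (pd j (V l)) = pd j (pd k (V l)) := funext fun y => pd_comm (hV l) _ _ y
    rw [h1, h2, pd_comm (pd_smooth (hV l) k)]

theorem Sop_symm (V : Fin n → Euc n → ℝ) (i k : Fin n) : Sop V i k = Sop V k i := by
  funext x; unfold Sop; rw [kd_comm]; ring

theorem H_ident {ε : ℝ} (hε : 0 < ε) {w} (hw : IsW w) (H : Fin n → Fin n → Euc n → ℝ)
    (hH : ∀ i k, ContDiff ℝ (⊤ : ℕ∞) (H i k)) (hs : ∀ i k, H i k = H k i)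
    (V : Fin n → Euc n → ℝ) (hV : ∀ i, ContDiff ℝ (⊤ : ℕ∞) (V i)) (x : Euc n) :
    ctr w (fun i j k l => pd j (pd k (H i l)) x)
      = ctr w (fun i j k l => pd j (Dop ε (Tten H V) i l k) x + av ε l x * Dop ε (Tten H V) i k j x) := by
  rw [Dop_ident hε hw (Tten H V) (fun i k => (hH i k).sub (Sop_smooth V hV i k))
    (fun i k => by funext x; unfold Tten; rw [hs, Sop_symm])]
  have : ∀ i j k l, pd j (pd k (Tten H V i l)) x = pd j (pd k (H i l)) x - pd j (pd k (Sop V i l)) x := by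
    intro i j k l
    have f1 : pd k (Tten H V i l) = fun x => pd k (H i l) x - pd k (Sop V i l) x := by
      funext y; unfold Tten
      rw [pd_sub (sm_diff (hH i l) y) (sm_diff (Sop_smooth V hV i l) y)]
    rw [f1, pd_sub (sm_diff (pd_smooth (hH i l) k) x) (sm_diff (pd_smooth (Sop_smooth V hV i l) k) x)]
  simp only [this]
  rw [ctr_sub, Sop_ident hw V hV, sub_zero]
end ident
end S5

namespace S5
open MvPolynomial
section G
variable {n : ℕ}

/-- half annulus. -/
def reg (l₀ : Fin n) (r : ℝ) : Set (Euc n) :=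
  (Metric.ball (0 : Euc n) (2 * r) \ Metric.ball (0 : Euc n) r) ∩ {x : Euc n | 0 ≤ x l₀}

theorem cont_coord (i : Fin n) : Continuous (fun x : Euc n => x i) := (contDiff_coord i).continuous

theorem reg_meas (l₀ : Fin n) (r : ℝ) : MeasurableSet (reg l₀ r) := by
  unfold reg
  refine (measurableSet_ball.diff measurableSet_ball).inter ?_
  exact (isClosed_le continuous_const (cont_coord l₀)).measurableSet

theorem reg_int (l₀ : Fin n) (r : ℝ) {f : Euc n → ℝ} (hf : Continuous f) : IntegrableOn f (reg l₀ r) := by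
  have h : IntegrableOn f (closedBall (0 : Euc n) (2 * r)) :=
    hf.continuousOn.integrableOn_compact (isCompact_closedBall _ _)
  refine h.mono_set ?_
  rintro x ⟨⟨hx, _⟩, _⟩
  exact ball_subset_closedBall hx

theorem cs_reg (l₀ : Fin n) (r : ℝ) {f g : Euc n → ℝ} (hf : Continuous f) (hg : Continuous g) :
    (∫ x in reg l₀ r, f x * g x) ^ 2 ≤ (∫ x in reg l₀ r, f x ^ 2) * ∫ x in reg l₀ r, g x ^ 2 := by
  have h : ∀ t : ℝ, 0 ≤ (∫ x in reg l₀ r, g x ^ 2) * (t * t) + (-2 * ∫ x in reg l₀ r, f x * g x) * t + ∫ x in reg l₀ r, f x ^ 2 := by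
    intro t
    have h0 : 0 ≤ ∫ x in reg l₀ r, (f x - t * g x) ^ 2 := integral_nonneg fun x => sq_nonneg _
    have e : ∫ x in reg l₀ r, (f x - t * g x) ^ 2 = ∫ x in reg l₀ r, ((t * t) * g x ^ 2 + ((-2 * t) * (f x * g x) + f x ^ 2)) := by
      congr 1; funext x; ring
    rw [e, integral_add, integral_add, integral_const_mul, integral_const_mul] at h0
    · linarith
    · exact reg_int l₀ r (f := fun x => (-2 * t) * (f x * g x)) (by fun_prop)
    · exact reg_int l₀ r (f := fun x => f x ^ 2) (by fun_prop)
    · exact reg_int l₀ r (f := fun x => (t * t) * g x ^ 2) (by fun_prop)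
    · exact reg_int l₀ r (f := fun x => (-2 * t) * (f x * g x) + f x ^ 2) (by fun_prop)
  have := discrim_le_zero h
  unfold discrim at this
  nlinarith

/-- The energy. -/
def NN (l₀ : Fin n) (ε : ℝ) (T : Fin n → Fin n → Euc n → ℝ) : ℝ :=
  ∫ x in reg l₀ 1, ∑ i, ∑ k, ∑ l, (Dop ε T i k l x) ^ 2

theorem Dop_smooth {ε : ℝ} (hε : 0 < ε) {T : Fin n → Fin n → Euc n → ℝ} (hT : ∀ i k, ContDiff ℝ (⊤ : ℕ∞) (T i k)) (i k l : Fin n) :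
    ContDiff ℝ (⊤ : ℕ∞) (Dop ε T i k l) := by
  unfold Dop
  have hE : ∀ i, ContDiff ℝ (⊤ : ℕ∞) (fun x => ∑ p, av ε p x * T i p x) := fun i =>
    ContDiff.sum fun p _ => (av_smooth hε p).mul (hT i p)
  exact ((((pd_smooth (hT i k) l).sub ((av_smooth hε i).mul (hT k l))).sub ((av_smooth hε k).mul (hT i l))).add
    ((hE i).mul contDiff_const)).add ((hE k).mul contDiff_const)

theorem NN_nonneg (l₀ : Fin n) (ε : ℝ) (T : Fin n → Fin n → Euc n → ℝ) : 0 ≤ NN l₀ ε T :=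
  integral_nonneg fun x => Finset.sum_nonneg fun _ _ => Finset.sum_nonneg fun _ _ => Finset.sum_nonneg fun _ _ => sq_nonneg _

theorem NN_ge (l₀ : Fin n) {ε : ℝ} (hε : 0 < ε) {T : Fin n → Fin n → Euc n → ℝ} (hT : ∀ i k, ContDiff ℝ (⊤ : ℕ∞) (T i k)) (i k l : Fin n) :
    ∫ x in reg l₀ 1, (Dop ε T i k l x) ^ 2 ≤ NN l₀ ε T := by
  have hc : ∀ i k l, Continuous (Dop ε T i k l) := fun i k l => (Dop_smooth hε hT i k l).continuous
  apply integral_mono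
  · exact reg_int l₀ 1 ((hc i k l).pow 2)
  · exact reg_int l₀ 1 (continuous_finset_sum _ fun i _ => continuous_finset_sum _ fun k _ => continuous_finset_sum _ fun l _ => (hc i k l).pow 2)
  · intro x
    simp only
    have h3 := Finset.single_le_sum (f := fun l => (Dop ε T i k l x) ^ 2) (fun _ _ => sq_nonneg _) (Finset.mem_univ l)
    have h2 := Finset.single_le_sum (f := fun k => ∑ l, (Dop ε T i k l x) ^ 2) (fun _ _ => Finset.sum_nonneg fun _ _ => sq_nonneg _) (Finset.mem_univ k)
    have h1 := Finset.single_le_sum (f := fun i => ∑ k, ∑ l, (Dop ε T i k l x) ^ 2) (fun _ _ => Finset.sum_nonneg fun _ _ => Finset.sum_nonneg fun _ _ => sq_nonneg _) (Finset.mem_univ i)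
    try simp only at h1 h2 h3
    linarith

theorem av_le (l₀ : Fin n) {ε : ℝ} (hε : 0 < ε) (i : Fin n) (x : Euc n) (hx : x ∈ reg l₀ 1) : (av ε i x) ^ 2 ≤ 4 := by
  have h1 : 1 ≤ ‖x‖ := by
    have := hx.1.2
    simpa using this
  have h2 : |x i| ≤ ‖x‖ := by
    have := PiLp.norm_apply_le x i
    simpa using this
  have h3 : |av ε i x| ≤ 2 := by
    unfold av
    rw [abs_div, abs_mul, abs_of_pos (rho_pos hε x), div_le_iff₀ (rho_pos hε x)]
    simp
    nlinarith [sq_nonneg ε]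
  rw [← sq_abs]
  nlinarith [abs_nonneg (av ε i x)]

theorem ctr_abs_le (w f : Fin n → Fin n → Fin n → Fin n → ℝ) (B : ℝ) (h : ∀ i j k l, |f i j k l| ≤ B) :
    |ctr w f| ≤ (∑ i, ∑ j, ∑ k, ∑ l, |w i j k l|) * B := by
  simp only [ctr, Finset.sum_mul]
  refine (Finset.abs_sum_le_sum_abs _ _).trans (Finset.sum_le_sum fun i _ => ?_)
  refine (Finset.abs_sum_le_sum_abs _ _).trans (Finset.sum_le_sum fun j _ => ?_)
  refine (Finset.abs_sum_le_sum_abs _ _).trans (Finset.sum_le_sum fun k _ => ?_)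
  refine (Finset.abs_sum_le_sum_abs _ _).trans (Finset.sum_le_sum fun l _ => ?_)
  rw [abs_mul]
  exact mul_le_mul_of_nonneg_left (h i j k l) (abs_nonneg _)

theorem cc_int {f φ : Euc n → ℝ} (hf : Continuous f) (hφ : Continuous φ) (hc : HasCompactSupport φ) :
    Integrable (fun x => f x * φ x) :=
  (hf.mul hφ).integrable_of_hasCompactSupport hc.mul_left

theorem pd_supp {φ : Euc n → ℝ} (i : Fin n) : tsupport (pd i φ) ⊆ tsupport φ := by
  have := tsupport_fderiv_apply_subset ℝ (f := φ) (EuclideanSpace.single i 1)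
  exact this

theorem ibp {f φ : Euc n → ℝ} (hf : ContDiff ℝ (⊤ : ℕ∞) f) (hφ : ContDiff ℝ (⊤ : ℕ∞) φ) (hc : HasCompactSupport φ) (j : Fin n) :
    ∫ x, pd j f x * φ x = - ∫ x, f x * pd j φ x := by
  have hc' : HasCompactSupport (pd j φ) := hc.of_isClosed_subset (isClosed_tsupport _) (pd_supp j)
  have h1 := cc_int (pd_smooth hf j).continuous hφ.continuous hc
  have h2 := cc_int hf.continuous (pd_smooth hφ j).continuous hc'
  have h3 := cc_int hf.continuous hφ.continuous hc
  have := integral_mul_fderiv_eq_neg_fderiv_mul_of_integrable (μ := volume) (f := f) (g := φ) (v := EuclideanSpace.single j 1) h1 h2 h3 (fun x _ => sm_diff hf x) (fun x _ => sm_diff hφ x)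
  unfold pd
  linarith

theorem G_main (l₀ : Fin n) {w} (hw : IsW w) (φ : Euc n → ℝ) (hφ : ContDiff ℝ (⊤ : ℕ∞) φ) (hc : HasCompactSupport φ)
    (hsupp : tsupport φ ⊆ reg l₀ 1) :
    ∃ C, ∀ ε : ℝ, 0 < ε → ∀ (H : Fin n → Fin n → Euc n → ℝ), (∀ i k, ContDiff ℝ (⊤ : ℕ∞) (H i k)) → (∀ i k, H i k = H k i) →
      ∀ (V : Fin n → Euc n → ℝ), (∀ i, ContDiff ℝ (⊤ : ℕ∞) (V i)) →
      (∫ x, ctr w (fun i j k l => pd j (pd k (H i l)) x) * φ x) ^ 2 ≤ C * NN l₀ ε (Tten H V) := by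
  set Cφ : ℝ := ∑ j, 2 * (∫ x in reg l₀ 1, (pd j φ x) ^ 2) + 8 * ∫ x in reg l₀ 1, φ x ^ 2 with hCφ
  refine ⟨(∑ i, ∑ j, ∑ k, ∑ l, |w i j k l|) ^ 2 * Cφ, ?_⟩
  intro ε hε H hH hs V hV
  have hT : ∀ i k, ContDiff ℝ (⊤ : ℕ∞) (Tten H V i k) := fun i k => (hH i k).sub (Sop_smooth V hV i k)
  set T := Tten H V with hTdef
  have hD := Dop_smooth hε hT
  have hI : ∀ j, 0 ≤ ∫ x in reg l₀ 1, (pd j φ x) ^ 2 := fun j => integral_nonneg fun x => sq_nonneg _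
  have hI0 : 0 ≤ ∫ x in reg l₀ 1, φ x ^ 2 := integral_nonneg fun x => sq_nonneg _
  have hCn : 0 ≤ Cφ := add_nonneg (Finset.sum_nonneg fun j _ => mul_nonneg (by norm_num) (hI j)) (by positivity)
  have hN := NN_nonneg l₀ ε T
  have hc' : ∀ j, HasCompactSupport (pd j φ) := fun j => hc.of_isClosed_subset (isClosed_tsupport _) (pd_supp j)
  have hint : ∀ i j k l, Integrable (fun x => (pd j (Dop ε T i l k) x + av ε l x * Dop ε T i k j x) * φ x) := fun i j k l =>
    cc_int ((pd_smooth (hD i l k) j).add ((av_smooth hε l).mul (hD i k j))).continuous hφ.continuous hc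
  have e1 : ∫ x, ctr w (fun i j k l => pd j (pd k (H i l)) x) * φ x
      = ctr w (fun i j k l => - (∫ x, Dop ε T i l k x * pd j φ x) + ∫ x, Dop ε T i k j x * (av ε l x * φ x)) := by
    simp_rw [H_ident hε hw H hH hs V hV]
    have e2 : ∀ i j k l, - (∫ x, Dop ε T i l k x * pd j φ x) + (∫ x, Dop ε T i k j x * (av ε l x * φ x))
        = ∫ x, (pd j (Dop ε T i l k) x + av ε l x * Dop ε T i k j x) * φ x := by
      intro i j k l
      rw [← ibp (hD i l k) hφ hc j, ← integral_add]
      · congr 1; funext x; ring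
      · exact cc_int (pd_smooth (hD i l k) j).continuous hφ.continuous hc
      · exact cc_int (hD i k j).continuous ((av_smooth hε l).continuous.mul hφ.continuous) hc.mul_left
    simp_rw [e2]
    simp only [ctr, Finset.sum_mul]
    rw [integral_finset_sum]
    · refine Finset.sum_congr rfl fun i _ => ?_
      rw [integral_finset_sum]
      · refine Finset.sum_congr rfl fun j _ => ?_
        rw [integral_finset_sum]
        · refine Finset.sum_congr rfl fun k _ => ?_
          rw [integral_finset_sum]
          · refine Finset.sum_congr rfl fun l _ => ?_
            rw [← integral_const_mul]
            congr 1; funext x; ring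
          · intro l _; simp_rw [mul_assoc (w _ _ _ _)]; exact (hint i j k l).const_mul _
        · intro k _; refine integrable_finset_sum _ fun l _ => ?_
          simp_rw [mul_assoc (w _ _ _ _)]; exact (hint i j k l).const_mul _
      · intro j _; refine integrable_finset_sum _ fun k _ => integrable_finset_sum _ fun l _ => ?_
        simp_rw [mul_assoc (w _ _ _ _)]; exact (hint i j k l).const_mul _
    · intro i _; refine integrable_finset_sum _ fun j _ => integrable_finset_sum _ fun k _ => integrable_finset_sum _ fun l _ => ?_
      simp_rw [mul_assoc (w _ _ _ _)]; exact (hint i j k l).const_mul _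
  have hset : ∀ (f ψ : Euc n → ℝ), tsupport ψ ⊆ tsupport φ → ∫ x, f x * ψ x = ∫ x in reg l₀ 1, f x * ψ x := by
    intro f ψ hψ
    rw [setIntegral_eq_integral_of_forall_compl_eq_zero]
    intro x hx
    have : x ∉ tsupport ψ := fun h => hx (hsupp (hψ h))
    rw [image_eq_zero_of_notMem_tsupport this, mul_zero]
  rw [e1]
  have hb : ∀ i j k l, |- (∫ x, Dop ε T i l k x * pd j φ x) + ∫ x, Dop ε T i k j x * (av ε l x * φ x)| ≤ Real.sqrt (Cφ * NN l₀ ε T) := by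
    intro i j k l
    apply Real.abs_le_sqrt
    rw [hset _ _ (pd_supp j), hset _ (fun x => av ε l x * φ x) (closure_mono (by
      intro x hx; simp only [Function.mem_support] at hx ⊢; exact right_ne_zero_of_mul hx))]
    have a1 := cs_reg l₀ 1 (hD i l k).continuous (pd_smooth hφ j).continuous
    have a2 := cs_reg l₀ 1 (hD i k j).continuous (g := fun x => av ε l x * φ x) ((av_smooth hε l).continuous.mul hφ.continuous)
    have a3 : ∫ x in reg l₀ 1, (av ε l x * φ x) ^ 2 ≤ 4 * ∫ x in reg l₀ 1, φ x ^ 2 := by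
      rw [← integral_const_mul]
      apply setIntegral_mono_on
      · exact reg_int l₀ 1 (((av_smooth hε l).continuous.mul hφ.continuous).pow 2)
      · exact reg_int l₀ 1 (continuous_const.mul (hφ.continuous.pow 2))
      · exact reg_meas l₀ 1
      · intro x hx
        rw [mul_pow]
        exact mul_le_mul_of_nonneg_right (av_le l₀ hε l x hx) (sq_nonneg _)
    have b1 := NN_ge l₀ hε hT i l k
    have b2 := NN_ge l₀ hε hT i k j
    have c1 := a1.trans (mul_le_mul_of_nonneg_right b1 (hI j))
    have c2 := a2.trans (mul_le_mul b2 a3 (integral_nonneg fun x => sq_nonneg _) hN)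
    have d1 := Finset.single_le_sum (f := fun j => 2 * ∫ x in reg l₀ 1, (pd j φ x) ^ 2) (fun j _ => mul_nonneg (by norm_num) (hI j)) (Finset.mem_univ j)
    try simp only at d1
    have d2 : (2 * (∫ x in reg l₀ 1, (pd j φ x) ^ 2) + 8 * ∫ x in reg l₀ 1, φ x ^ 2) * NN l₀ ε T ≤ Cφ * NN l₀ ε T :=
      mul_le_mul_of_nonneg_right (by rw [hCφ]; linarith) hN
    refine le_trans ?_ d2
    set u := ∫ x in reg l₀ 1, Dop ε T i l k x * pd j φ x
    set v := ∫ x in reg l₀ 1, Dop ε T i k j x * (av ε l x * φ x)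
    nlinarith [sq_nonneg (u + v)]
  have := ctr_abs_le w _ _ hb
  rw [← sq_abs]
  calc _ ≤ ((∑ i, ∑ j, ∑ k, ∑ l, |w i j k l|) * Real.sqrt (Cφ * NN l₀ ε T)) ^ 2 := by
        apply pow_le_pow_left₀ (abs_nonneg _) this
    _ = _ := by rw [mul_pow, Real.sq_sqrt (mul_nonneg hCn hN)]; ring
end G
end S5

namespace S5
open MvPolynomial
section H
variable {n d : ℕ}

/-- multi-index as finsupp. -/
def mi (α : Fin n → ℕ) : Fin n →₀ ℕ := Finsupp.equivFunOnFinite.symm α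

/-- The polynomial of coefficients. -/
def PP (g : Fin n → Fin n → MIdx n d → ℝ) (i k : Fin n) : MvPolynomial (Fin n) ℝ :=
  ∑ α : MIdx n d, monomial (mi α.1) (g i k α)

theorem PP_add (g g' : Fin n → Fin n → MIdx n d → ℝ) (i k : Fin n) : PP (g + g') i k = PP g i k + PP g' i k := by
  simp [PP, Finset.sum_add_distrib]
theorem PP_smul (c : ℝ) (g : Fin n → Fin n → MIdx n d → ℝ) (i k : Fin n) : PP (c • g) i k = c • PP g i k := by
  simp [PP, Finset.smul_sum, smul_monomial]
theorem PP_zero (i k : Fin n) : PP (0 : Fin n → Fin n → MIdx n d → ℝ) i k = 0 := by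
  simp [PP]
theorem PP_coeff (g : Fin n → Fin n → MIdx n d → ℝ) (i k : Fin n) (β : MIdx n d) : coeff (mi β.1) (PP g i k) = g i k β := by
  classical
  simp only [PP, coeff_sum, coeff_monomial]
  rw [Finset.sum_eq_single β]
  · simp
  · intro b _ hb
    rw [if_neg]
    intro h
    exact hb (Subtype.ext (Finsupp.equivFunOnFinite.symm.injective h))
  · simp
theorem PP_eval (g : Fin n → Fin n → MIdx n d → ℝ) (i k : Fin n) (x : Euc n) :
    fe (PP g i k) x = ∑ α : MIdx n d, g i k α * ∏ m, x m ^ α.1 m := by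
  simp only [fe, PP, map_sum, eval_monomial]
  refine Finset.sum_congr rfl fun α _ => ?_
  congr 1
  rw [Finsupp.prod_fintype _ _ (by simp)]
  rfl

/-- admissible coefficients. -/
def Adm (n d : ℕ) (l₀ : Fin n) : Submodule ℝ (Fin n → Fin n → MIdx n d → ℝ) where
  carrier := {g | (∀ i k, PP g i k = PP g k i) ∧ (∀ i, PP g i l₀ = 0) ∧ (∑ i, PP g i i = 0) ∧
    (∀ x : Fin n → ℝ, x l₀ = 0 → ∀ i, ∑ k, eval x (PP g i k) * x k = 0) ∧
    (∀ x : Fin n → ℝ, x l₀ = 0 → ∀ i k, eval x (pderiv l₀ (PP g i k)) = 0)}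
  zero_mem' := by
    simp [PP_zero]
  add_mem' := by
    rintro g g' ⟨a1, a2, a3, a4, a5⟩ ⟨b1, b2, b3, b4, b5⟩
    refine ⟨?_, ?_, ?_, ?_, ?_⟩
    · intro i k; rw [PP_add, PP_add, a1, b1]
    · intro i; rw [PP_add, a2, b2, add_zero]
    · simp [PP_add, Finset.sum_add_distrib, a3, b3]
    · intro x hx i; simp [PP_add, add_mul, Finset.sum_add_distrib, a4 x hx i, b4 x hx i]
    · intro x hx i k; simp [PP_add, a5 x hx i k, b5 x hx i k]
  smul_mem' := by
    rintro c g ⟨a1, a2, a3, a4, a5⟩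
    refine ⟨?_, ?_, ?_, ?_, ?_⟩
    · intro i k; rw [PP_smul, PP_smul, a1]
    · intro i; rw [PP_smul, a2, smul_zero]
    · simp [PP_smul, ← Finset.smul_sum, a3]
    · intro x hx i; simp [PP_smul, smul_eval, mul_assoc, ← Finset.mul_sum, a4 x hx i]
    · intro x hx i k; simp [PP_smul, smul_eval, a5 x hx i k]

/-- contraction of second derivatives, polynomial version. -/
def LW (w : Fin n → Fin n → Fin n → Fin n → ℝ) (g : Fin n → Fin n → MIdx n d → ℝ) : MvPolynomial (Fin n) ℝ :=
  ∑ i, ∑ j, ∑ k, ∑ l, w i j k l • pderiv j (pderiv k (PP g i l))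

theorem LW_add (w) (g g' : Fin n → Fin n → MIdx n d → ℝ) : LW w (g + g') = LW w g + LW w g' := by
  simp [LW, PP_add, Finset.sum_add_distrib]
theorem LW_smul (w) (c : ℝ) (g : Fin n → Fin n → MIdx n d → ℝ) : LW w (c • g) = c • LW w g := by
  simp only [LW, PP_smul, Derivation.map_smul, Finset.smul_sum, smul_comm c]
theorem LW_fe (w) (g : Fin n → Fin n → MIdx n d → ℝ) (x : Euc n) :
    fe (LW w g) x = ctr w (fun i j k l => pd j (pd k (fe (PP g i l))) x) := by
  simp only [pd_fe, ctr]
  simp [fe, LW, smul_eval]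

/-- integral functional. -/
def Lam (l₀ : Fin n) (w : Fin n → Fin n → Fin n → Fin n → ℝ) (φ : Euc n → ℝ) (hφ : Continuous φ) (hc : HasCompactSupport φ) :
    Module.Dual ℝ (Adm n d l₀) where
  toFun g := ∫ x, fe (LW w g.1) x * φ x
  map_add' := by
    intro g g'
    simp only [Submodule.coe_add, LW_add, fe_add, add_mul]
    exact integral_add (cc_int (fe_smooth _).continuous hφ hc) (cc_int (fe_smooth _).continuous hφ hc)
  map_smul' := by
    intro c g
    simp only [Submodule.coe_smul, LW_smul, RingHom.id_apply, smul_eq_mul]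
    rw [← integral_const_mul]
    congr 1; funext x; simp [fe, smul_eval, mul_assoc]

/-- The tensor of functions. -/
def HH (g : Fin n → Fin n → MIdx n d → ℝ) (i k : Fin n) : Euc n → ℝ := fe (PP g i k)

/-- controlled functionals. -/
def FF (n d : ℕ) (l₀ : Fin n) : Submodule ℝ (Module.Dual ℝ (Adm n d l₀)) where
  carrier := {f | ∃ C, ∀ (g : Adm n d l₀) (ε : ℝ), 0 < ε → ∀ (V : Fin n → Euc n → ℝ), (∀ i, ContDiff ℝ (⊤ : ℕ∞) (V i)) →
    (f g) ^ 2 ≤ C * NN l₀ ε (Tten (HH g.1) V)}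
  zero_mem' := ⟨0, by intros; simp⟩
  add_mem' := by
    rintro f f' ⟨C, hC⟩ ⟨C', hC'⟩
    refine ⟨2 * C + 2 * C', ?_⟩
    intro g ε hε V hV
    have h1 := hC g ε hε V hV
    have h2 := hC' g ε hε V hV
    rw [LinearMap.add_apply]
    nlinarith [sq_nonneg (f g - f' g)]
  smul_mem' := by
    rintro c f ⟨C, hC⟩
    refine ⟨c ^ 2 * C, ?_⟩
    intro g ε hε V hV
    rw [LinearMap.smul_apply, smul_eq_mul, mul_pow, mul_assoc]
    exact mul_le_mul_of_nonneg_left (hC g ε hε V hV) (sq_nonneg _)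

theorem FF_sep (hn : 6 ≤ n) (l₀ : Fin n) (g : Adm n d l₀) (hg : ∀ f ∈ FF n d l₀, f g = 0) : g = 0 := by
  set U : Set (Euc n) := {x | 1 < ‖x‖ ∧ ‖x‖ < 2 ∧ 0 < x l₀} with hU
  have hUo : IsOpen U := by
    refine (isOpen_lt continuous_const continuous_norm).inter ((isOpen_lt continuous_norm continuous_const).inter (isOpen_lt continuous_const (cont_coord l₀)))
  have hUn : U.Nonempty := by
    refine ⟨EuclideanSpace.single l₀ (3 / 2), ?_, ?_, ?_⟩ <;> simp <;> norm_num [abs_of_pos]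
  have hUr : U ⊆ reg l₀ 1 := by
    rintro x ⟨h1, h2, h3⟩
    refine ⟨⟨by simpa using h2, by simpa using h1.le⟩, h3.le⟩
  have key : ∀ w, IsW w → LW w g.1 = 0 := by
    intro w hw
    apply fe_zero_of_open _ U hUo hUn
    have hae : ∀ᵐ x ∂(volume : Measure (Euc n)), x ∈ U → fe (LW w g.1) x = 0 := by
      apply hUo.ae_eq_zero_of_integral_contDiff_smul_eq_zero
      · exact (fe_smooth _).continuous.locallyIntegrable.locallyIntegrableOn _
      · intro φ hφ hc hs
        have hm : Lam (d := d) l₀ w φ hφ.continuous hc ∈ FF n d l₀ := by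
          obtain ⟨C, hC⟩ := G_main l₀ hw φ hφ hc (hs.trans hUr)
          refine ⟨C, ?_⟩
          intro g ε hε V hV
          have := hC ε hε (HH g.1) (fun i k => fe_smooth _) (fun i k => by unfold HH; rw [g.2.1]) V hV
          refine le_trans (le_of_eq ?_) this
          show (∫ x, fe (LW w g.1) x * φ x) ^ 2 = _
          simp only [LW_fe]
          rfl
        have := hg _ hm
        refine Eq.trans ?_ this
        show _ = ∫ x, fe (LW w g.1) x * φ x
        congr 1; funext x; rw [smul_eq_mul, mul_comm]
    have := MeasureTheory.Measure.eqOn_open_of_ae_eq (μ := (volume : Measure (Euc n))) (f := fe (LW w g.1)) (g := fun _ => (0:ℝ)) (U := U)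
      ((ae_restrict_iff' hUo.measurableSet).2 hae) hUo (fe_smooth _).continuous.continuousOn continuousOn_const
    exact fun x hx => this hx
  obtain ⟨a1, a2, a3, a4, a5⟩ := g.2
  have hz := alg_main (by simpa using hn) l₀ (PP g.1) a1 a2 a3 a4 a5 (by
    intro w hw x
    have := congrArg (eval x) (key w hw)
    simpa [LW, smul_eval] using this)
  apply Subtype.ext
  funext i k β
  rw [← PP_coeff g.1, hz]; simp

theorem FF_top (hn : 6 ≤ n) (l₀ : Fin n) : FF n d l₀ = ⊤ := by
  have h : (FF n d l₀).dualCoannihilator = ⊥ := by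
    rw [eq_bot_iff]
    intro g hg
    rw [Submodule.mem_dualCoannihilator] at hg
    exact FF_sep hn l₀ g hg
  rw [← Subspace.dualCoannihilator_dualAnnihilator_eq (W := FF n d l₀), h, Submodule.dualAnnihilator_bot]

theorem H_main (hn : 6 ≤ n) (l₀ : Fin n) : ∃ C : ℝ, 0 < C ∧ ∀ g ∈ Adm n d l₀, ∀ ε : ℝ, 0 < ε → ∀ (V : Fin n → Euc n → ℝ), (∀ i, ContDiff ℝ (⊤ : ℕ∞) (V i)) →
    ∑ α : MIdx n d, ∑ i, ∑ k, (g i k α) ^ 2 ≤ C * NN l₀ ε (Tten (HH g) V) := by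
  have h : ∀ (α : MIdx n d) (i k : Fin n), ∃ C, ∀ g ∈ Adm n d l₀, ∀ (ε : ℝ), 0 < ε → ∀ (V : Fin n → Euc n → ℝ), (∀ i, ContDiff ℝ (⊤ : ℕ∞) (V i)) →
    (g i k α) ^ 2 ≤ C * NN l₀ ε (Tten (HH g) V) := by
    intro α i k
    have hm : ((LinearMap.proj α : (MIdx n d → ℝ) →ₗ[ℝ] ℝ) ∘ₗ (LinearMap.proj k : (Fin n → MIdx n d → ℝ) →ₗ[ℝ] _) ∘ₗ (LinearMap.proj i : (Fin n → Fin n → MIdx n d → ℝ) →ₗ[ℝ] _)) ∘ₗ (Adm n d l₀).subtype ∈ FF n d l₀ := by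
      rw [FF_top hn l₀]; exact Submodule.mem_top
    obtain ⟨C, hC⟩ := hm
    exact ⟨C, fun g hg => hC ⟨g, hg⟩⟩
  choose C hC using h
  refine ⟨|∑ α, ∑ i, ∑ k, C α i k| + 1, by positivity, ?_⟩
  intro g hg ε hε V hV
  have hN := NN_nonneg l₀ ε (Tten (HH g) V)
  calc _ ≤ ∑ α, ∑ i, ∑ k, C α i k * NN l₀ ε (Tten (HH g) V) :=
        Finset.sum_le_sum fun α _ => Finset.sum_le_sum fun i _ => Finset.sum_le_sum fun k _ => hC α i k g hg ε hε V hV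
    _ = (∑ α, ∑ i, ∑ k, C α i k) * NN l₀ ε (Tten (HH g) V) := by simp only [Finset.sum_mul]
    _ ≤ _ := mul_le_mul_of_nonneg_right (by linarith [le_abs_self (∑ α, ∑ i, ∑ k, C α i k)]) hN
end H
end S5

namespace S5
open MvPolynomial
section I
open scoped Pointwise
variable {n d : ℕ}

theorem fe_inj {p q : MvPolynomial (Fin n) ℝ} (h : ∀ x, fe p x = fe q x) : p = q := by
  apply MvPolynomial.funext
  intro y
  simpa [fe] using h (WithLp.toLp 2 y)

theorem pd_scale (f : Euc n → ℝ) (r : ℝ) (i : Fin n) (x : Euc n) :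
    pd i (fun x => f (r • x)) x = r * pd i f (r • x) := by
  unfold pd
  rw [fderiv_comp_smul]; rfl

theorem av_scale {ε r : ℝ} (hr : 0 < r) (hε : 0 < ε) (i : Fin n) (x : Euc n) :
    av (ε / r) i x = r * av ε i (r • x) := by
  unfold av
  have h1 := rho_pos (n := n) hε (r • x)
  have h2 := rho_pos (n := n) (div_pos hε hr) x
  rw [norm_smul, Real.norm_of_nonneg hr.le] at *
  rw [div_pow] at *
  simp only [PiLp.smul_apply, smul_eq_mul]
  have : ε ^ 2 + (r * ‖x‖) ^ 2 = r ^ 2 * (ε ^ 2 / r ^ 2 + ‖x‖ ^ 2) := by field_simp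
  rw [this]
  field_simp

theorem Dop_scale {ε r : ℝ} (hr : 0 < r) (hε : 0 < ε) (T : Fin n → Fin n → Euc n → ℝ) (i k l : Fin n) (x : Euc n) :
    Dop (ε / r) (fun i k x => T i k (r • x)) i k l x = r * Dop ε T i k l (r • x) := by
  unfold Dop
  simp only [av_scale hr hε, pd_scale, mul_assoc r, ← Finset.mul_sum]
  ring

theorem Tten_scale {r : ℝ} (hr : 0 < r) (H : Fin n → Fin n → Euc n → ℝ) (V : Fin n → Euc n → ℝ) :
    Tten (fun i k x => H i k (r • x)) (fun i x => r⁻¹ * V i (r • x)) = fun i k x => Tten H V i k (r • x) := by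
  have h : ∀ i k x, pd i (fun x => r⁻¹ * V k (r • x)) x = pd i (V k) (r • x) := by
    intro i k x
    have := pd_scale (fun x => r⁻¹ * V k x) r i x
    rw [this]
    have h2 : pd i (fun x => r⁻¹ * V k x) (r • x) = r⁻¹ * pd i (V k) (r • x) := by
      unfold pd
      have : (fun x => r⁻¹ * V k x) = r⁻¹ • V k := rfl
      rw [this, fderiv_const_smul_field]; rfl
    rw [h2]; field_simp
  funext i k x
  unfold Tten Sop
  simp only [h]

theorem reg_scale (l₀ : Fin n) {r : ℝ} (hr : 0 < r) : r • reg l₀ 1 = reg l₀ r := by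
  ext x
  rw [Set.mem_smul_set_iff_inv_smul_mem₀ hr.ne']
  simp only [reg, Set.mem_inter_iff, Set.mem_diff, mem_ball_zero_iff, Set.mem_setOf_eq, norm_smul, norm_inv, Real.norm_of_nonneg hr.le, PiLp.smul_apply, smul_eq_mul]
  rw [inv_mul_lt_iff₀ hr, inv_mul_lt_iff₀ hr]
  have : 0 ≤ r⁻¹ * x l₀ ↔ 0 ≤ x l₀ := by
    constructor
    · intro h; exact nonneg_of_mul_nonneg_right h (inv_pos.2 hr)
    · intro h; positivity
  rw [this, mul_one, mul_one, mul_comm r 2]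

theorem NN_scale (l₀ : Fin n) {ε r : ℝ} (hr : 0 < r) (hε : 0 < ε) (T : Fin n → Fin n → Euc n → ℝ) :
    NN l₀ (ε / r) (fun i k x => T i k (r • x)) = r ^ 2 * ((r ^ n)⁻¹ * ∫ x in reg l₀ r, ∑ i, ∑ k, ∑ l, (Dop ε T i k l x) ^ 2) := by
  unfold NN
  have := Measure.setIntegral_comp_smul_of_pos (volume : Measure (Euc n)) (fun x => ∑ i, ∑ k, ∑ l, (Dop ε T i k l x) ^ 2) (reg l₀ 1) hr
  rw [reg_scale l₀ hr, finrank_euclideanSpace, Fintype.card_fin, smul_eq_mul] at this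
  rw [← this, ← integral_const_mul]
  congr 1
  funext x
  simp only [Dop_scale hr hε, mul_pow, Finset.mul_sum]

theorem Q_lower (hn : 6 ≤ n) (l₀ : Fin n) {ε r : ℝ} (hε : 0 < ε) (hr : ε ≤ r) (H : Fin n → Fin n → Euc n → ℝ)
    (hH : ∀ i k, ContDiff ℝ (⊤ : ℕ∞) (H i k)) (V : Fin n → Euc n → ℝ) (hV : ∀ i, ContDiff ℝ (⊤ : ℕ∞) (V i)) :
    (ε / (5 * r ^ 2)) ^ (n - 2) * ∫ x in reg l₀ r, ∑ i, ∑ k, ∑ l, (Dop ε (Tten H V) i k l x) ^ 2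
      ≤ ∫ x in reg l₀ r, ∑ i, ∑ k, ∑ l, (Qop ε H V i k l x) ^ 2 := by
  have hr0 : 0 < r := hε.trans_le hr
  have hT : ∀ i k, ContDiff ℝ (⊤ : ℕ∞) (Tten H V i k) := fun i k => (hH i k).sub (Sop_smooth V hV i k)
  have hc : ∀ i k l, Continuous (Dop ε (Tten H V) i k l) := fun i k l => (Dop_smooth hε hT i k l).continuous
  have hF : Continuous (fun x => ∑ i, ∑ k, ∑ l, (Dop ε (Tten H V) i k l x) ^ 2) :=
    continuous_finset_sum _ fun i _ => continuous_finset_sum _ fun k _ => continuous_finset_sum _ fun l _ => (hc i k l).pow 2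
  have hu : ∀ x : Euc n, (uE n ε x) ^ 2 = (ε / (ε ^ 2 + ‖x‖ ^ 2)) ^ (n - 2) := by
    intro x
    have h1 := rho_pos hε x
    unfold uE
    rw [← Real.rpow_natCast, ← Real.rpow_mul (by positivity), ← Real.rpow_natCast _ (n - 2)]
    congr 1
    rw [Nat.cast_sub (by omega)]; push_cast; ring
  have e : ∀ x, ∑ i, ∑ k, ∑ l, (Qop ε H V i k l x) ^ 2 = (ε / (ε ^ 2 + ‖x‖ ^ 2)) ^ (n - 2) * ∑ i, ∑ k, ∑ l, (Dop ε (Tten H V) i k l x) ^ 2 := by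
    intro x
    simp only [Qop_eq hε hn, mul_pow, hu, Finset.mul_sum]
  simp only [e]
  rw [← integral_const_mul]
  apply setIntegral_mono_on
  · exact reg_int l₀ r (continuous_const.mul hF)
  · refine reg_int l₀ r (Continuous.mul (Continuous.pow (Continuous.div continuous_const (by fun_prop) (fun x => (rho_pos hε x).ne')) _) hF)
  · exact reg_meas l₀ r
  · intro x hx
    apply mul_le_mul_of_nonneg_right
    · apply pow_le_pow_left₀ (by positivity)
      apply div_le_div_of_nonneg_left hε.le (rho_pos hε x)
      have h2 : ‖x‖ < 2 * r := by simpa using hx.1.1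
      nlinarith [norm_nonneg x]
    · exact Finset.sum_nonneg fun _ _ => Finset.sum_nonneg fun _ _ => Finset.sum_nonneg fun _ _ => sq_nonneg _
end I
end S5
open S5

/-- There exists `K₂ > 0`, depending only on `n`, such that for every `H` as in the
context, every `ε > 0`, every smooth vector field `V` on `ℝ^n_+` and every `r ≥ ε`:
`Σ |h_{ik,α}|² ε^{n-2} r^{2|α|+2-n} ≤ K₂ ∫_{(B_{2r}\B_r) ∩ ℝ^n_+} Σ |Q_{ik,l}|²`. -/
theorem statement5 (n : ℕ) (hn : 6 ≤ n) (l₀ : Fin n) (hl₀ : (l₀ : ℕ) = n - 1)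
    (d : ℕ) (hd : d = (n - 2) / 2) :
    ∃ K₂ : ℝ, 0 < K₂ ∧
      ∀ (h : Fin n → Fin n → (Fin n → ℕ) → ℝ) (H : Fin n → Fin n → Euc n → ℝ),
        (∀ i k x, H i k x = ∑ α ∈ MIdx n d, h i k α * ∏ m, x m ^ α m) →
        (∀ i k x, H i k x = H k i x) →
        (∀ x, ∑ i, H i i x = 0) →
        (∀ x : Euc n, 0 ≤ x l₀ → ∀ i, H i l₀ x = 0) →
        (∀ x : Euc n, x l₀ = 0 → ∀ i, ∑ k, H i k x * x k = 0) →
        (∀ x : Euc n, x l₀ = 0 → ∀ i k, pd l₀ (H i k) x = 0) →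
        ∀ ε : ℝ, 0 < ε →
        ∀ V : Fin n → Euc n → ℝ, (∀ i, ContDiff ℝ (⊤ : ℕ∞) (V i)) →
        ∀ r : ℝ, ε ≤ r →
          ∑ α ∈ MIdx n d, ∑ i, ∑ k,
              (h i k α) ^ 2 * ε ^ ((n : ℝ) - 2)
                * r ^ (2 * (∑ m, (α m : ℝ)) + 2 - (n : ℝ))
            ≤ K₂ * ∫ x in (Metric.ball (0 : Euc n) (2 * r) \ Metric.ball (0 : Euc n) r)
                  ∩ {x : Euc n | 0 ≤ x l₀},
                ∑ i, ∑ k, ∑ l, (Qop ε H V i k l x) ^ 2 := by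
  obtain ⟨C, hC0, hC⟩ := H_main (d := d) hn l₀
  refine ⟨C * 5 ^ (n - 2), by positivity, ?_⟩
  intro h H hH hsym htr hl hx hdd ε hε V hV r hr
  have hr0 : 0 < r := hε.trans_le hr
  change _ ≤ _ * ∫ x in reg l₀ r, ∑ i, ∑ k, ∑ l, (Qop ε H V i k l x) ^ 2
  have hHfe : ∀ i k, H i k = HH (fun i k (α : MIdx n d) => h i k α.1) i k := by
    intro i k; funext x
    unfold HH
    rw [PP_eval, hH, ← Finset.sum_coe_sort]
  have hHs : ∀ i k, ContDiff ℝ (⊤ : ℕ∞) (H i k) := fun i k => by rw [hHfe]; exact fe_smooth _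
  set g : Fin n → Fin n → MIdx n d → ℝ := fun i k α => h i k α.1 * r ^ (∑ m, α.1 m) with hgdef
  have hg : ∀ i k x, HH g i k x = H i k (r • x) := by
    intro i k x
    unfold HH
    rw [PP_eval, hH, ← Finset.sum_coe_sort (MIdx n d) (fun α => h i k α * ∏ m, (r • x) m ^ α m)]
    refine Finset.sum_congr (M := ℝ) rfl fun α _ => ?_
    simp only [hgdef, PiLp.smul_apply, smul_eq_mul, mul_pow, Finset.prod_mul_distrib, Finset.prod_pow_eq_pow_sum]
    ring
  have hgA : g ∈ Adm n d l₀ := by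
    refine ⟨?_, ?_, ?_, ?_, ?_⟩
    · intro i k; apply fe_inj; intro x
      have h1 := hg i k x; have h2 := hg k i x; unfold HH at h1 h2
      rw [h1, h2, hsym]
    · intro i
      apply fe_zero_of_open _ {x : Euc n | 0 < x l₀} (isOpen_lt continuous_const (cont_coord l₀)) ⟨EuclideanSpace.single l₀ 1, by simp⟩
      intro x hx0
      have h1 := hg i l₀ x; unfold HH at h1
      rw [h1]
      apply hl
      have : 0 < x l₀ := hx0
      simp only [PiLp.smul_apply, smul_eq_mul]; positivity
    · apply fe_inj; intro x
      have e : fe (∑ i, PP g i i) x = ∑ i, HH g i i x := by simp [fe, HH]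
      rw [e]; simp only [hg, htr]; simp [fe]
    · intro x hx0 i
      have h1 := hx (r • WithLp.toLp 2 x) (by simp [hx0]) i
      have e : ∀ k, H i k (r • WithLp.toLp 2 x) = MvPolynomial.eval x (PP g i k) := by
        intro k; rw [← hg]; rfl
      simp only [e, PiLp.smul_apply, smul_eq_mul] at h1
      have h2 : r * ∑ k, MvPolynomial.eval x (PP g i k) * x k = 0 := by
        rw [← h1, Finset.mul_sum]
        refine Finset.sum_congr rfl fun k _ => by ring
      exact (mul_eq_zero.1 h2).resolve_left hr0.ne'
    · intro x hx0 i k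
      have h1 := congrFun (pd_fe l₀ (PP g i k)) (WithLp.toLp 2 x)
      have h2 : fe (PP g i k) = fun x => H i k (r • x) := funext fun x => hg i k x
      rw [h2, pd_scale, hdd _ (by simp [hx0]), mul_zero] at h1
      exact h1.symm
  have hV' : ∀ i, ContDiff ℝ (⊤ : ℕ∞) (fun x => r⁻¹ * V i (r • x)) := fun i =>
    contDiff_const.mul ((hV i).comp (contDiff_const_smul r))
  have main := hC g hgA (ε / r) (div_pos hε hr0) _ hV'
  have hHg : HH g = fun i k x => H i k (r • x) := by funext i k x; exact hg i k x
  rw [hHg, Tten_scale hr0, NN_scale l₀ hr0 hε] at main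
  have low := Q_lower hn l₀ hε hr H hHs V hV
  set J := ∫ x in reg l₀ r, ∑ i, ∑ k, ∑ l, (Dop ε (Tten H V) i k l x) ^ 2
  set q := ∫ x in reg l₀ r, ∑ i, ∑ k, ∑ l, (Qop ε H V i k l x) ^ 2
  have hn2 : (n : ℝ) - 2 = ((n - 2 : ℕ) : ℝ) := by rw [Nat.cast_sub (by omega)]; norm_num
  have el : ∑ α ∈ MIdx n d, ∑ i, ∑ k, (h i k α) ^ 2 * ε ^ ((n : ℝ) - 2) * r ^ (2 * (∑ m, (α m : ℝ)) + 2 - (n : ℝ))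
      = (ε ^ (n - 2) / r ^ (n - 2)) * ∑ α : MIdx n d, ∑ i, ∑ k, (g i k α) ^ 2 := by
    rw [← Finset.sum_coe_sort, Finset.mul_sum]
    refine Finset.sum_congr rfl fun α _ => ?_
    conv_rhs => rw [Finset.mul_sum]
    refine Finset.sum_congr rfl fun i _ => ?_
    conv_rhs => rw [Finset.mul_sum]
    refine Finset.sum_congr rfl fun k _ => ?_
    have e1 : 2 * (∑ m, (α.1 m : ℝ)) + 2 - (n : ℝ) = ((2 * ∑ m, α.1 m : ℕ) : ℝ) - ((n - 2 : ℕ) : ℝ) := by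
      rw [← hn2]; push_cast; ring
    rw [e1, hn2, Real.rpow_sub hr0, Real.rpow_natCast, Real.rpow_natCast, Real.rpow_natCast]
    simp only [hgdef]
    rw [mul_pow, ← pow_mul, mul_comm 2]
    ring
  rw [el]
  have hpos : 0 < ε ^ (n - 2) / r ^ (n - 2) := by positivity
  calc _ ≤ (ε ^ (n - 2) / r ^ (n - 2)) * (C * (r ^ 2 * ((r ^ n)⁻¹ * J))) := mul_le_mul_of_nonneg_left main hpos.le
    _ = C * 5 ^ (n - 2) * ((ε / (5 * r ^ 2)) ^ (n - 2) * J) := by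
        have : r ^ n = r ^ (n - 2) * r ^ 2 := by rw [← pow_add]; congr 1; omega
        rw [this, div_pow, mul_pow, ← pow_mul, mul_comm 2 (n - 2), pow_mul]
        field_simp
    _ ≤ _ := mul_le_mul_of_nonneg_left low (by positivity)
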